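/- arXiv:1909.10241 — 2 statements merged into one kernel-verified Lean document; each statement's English description precedes it below -/
import Mathlib

section
/- Assume Schanuel's Conjecture. Let n ≥ 1 and let V ⊆ ℂ^n × (ℂ*)^n be an irreducible algebraic variety defined over the algebraic closure of ℚ with dim V = n, such that both the projection π₁ of V to the first n coordinates and the projection π₂ of V to the last n coordinates are dominant. Then the set of points (ā, e^{ā}) ∈ V with transcendence degree of ℚ(ā, e^{ā}) over ℚ equal to n is Zariski dense in V. -/
open MvPolynomial Complex

/-- The common zero set in `ℂ^σ` of a family of polynomials. -/
def zeroSet {σ : Type} (T : Set (MvPolynomial σ ℂ)) : Set (σ → ℂ) :=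
  {x | ∀ p ∈ T, eval x p = 0}

/-- A subset of `ℂ^σ` is Zariski closed if it is the common zero set of a
family of polynomials. -/
def IsZClosed {σ : Type} (s : Set (σ → ℂ)) : Prop :=
  ∃ T : Set (MvPolynomial σ ℂ), s = zeroSet T

/-- The Zariski closure of a subset of `ℂ^σ`. -/
def zClosure {σ : Type} (s : Set (σ → ℂ)) : Set (σ → ℂ) :=
  ⋂₀ {c : Set (σ → ℂ) | IsZClosed c ∧ s ⊆ c}

/-- A subset of `ℂ^σ` is Zariski dense if the only polynomial vanishing
identically on it is the zero polynomial. -/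
def IsZDense {σ : Type} (s : Set (σ → ℂ)) : Prop :=
  ∀ p : MvPolynomial σ ℂ, (∀ x ∈ s, eval x p = 0) → p = 0

/-- A subset of `ℂ^σ` is irreducible (for the Zariski topology). -/
def IsZIrreducible {σ : Type} (s : Set (σ → ℂ)) : Prop :=
  s.Nonempty ∧ ∀ c₁ c₂ : Set (σ → ℂ), IsZClosed c₁ → IsZClosed c₂ →
    s ⊆ c₁ ∪ c₂ → s ⊆ c₁ ∨ s ⊆ c₂

/-- The dimension of a subset of `ℂ^σ`: the Krull dimension of its Zariski
closure, i.e. the Krull dimension of the poset of irreducible Zariski closed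
subsets of the closure (`⊥ = -1` for the empty set). -/
noncomputable def zdim {σ : Type} (s : Set (σ → ℂ)) : WithBot ℕ∞ :=
  Order.krullDim {t : Set (σ → ℂ) // IsZClosed t ∧ IsZIrreducible t ∧ t ⊆ zClosure s}

/-- Constructible subsets of `ℂ^σ`: finite Boolean combinations of Zariski
closed sets. -/
inductive IsZConstructible {σ : Type} : Set (σ → ℂ) → Prop
  | of_closed (s : Set (σ → ℂ)) : IsZClosed s → IsZConstructible s
  | compl (s : Set (σ → ℂ)) : IsZConstructible s → IsZConstructible sᶜ
  | union (s t : Set (σ → ℂ)) : IsZConstructible s → IsZConstructible t →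
      IsZConstructible (s ∪ t)

/-- "The transcendence degree of `K(s)` over `K` is at least `r`":
there are `r` elements of `s` that are algebraically independent over `K`. -/
def TrdegGe (K : Type) [Field K] [Algebra K ℂ] (s : Set ℂ) (r : ℕ) : Prop :=
  ∃ t : Finset ℂ, ↑t ⊆ s ∧ t.card = r ∧
    AlgebraicIndependent K (Subtype.val : ↥(t : Set ℂ) → ℂ)

/-- "The transcendence degree of `K(s)` over `K` equals `m`": there is a
transcendence basis of `K(s)` over `K` consisting of `m` elements of `s`. -/
def TrdegEq (K : Type) [Field K] [Algebra K ℂ] (s : Set ℂ) (m : ℕ) : Prop :=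
  ∃ t : Finset ℂ, ↑t ⊆ s ∧ t.card = m ∧
    AlgebraicIndependent K (Subtype.val : ↥(t : Set ℂ) → ℂ) ∧
    ∀ x ∈ s, IsAlgebraic (↥(IntermediateField.adjoin K (t : Set ℂ))) x

/-- Schanuel's Conjecture: the transcendence degree over `ℚ` of
`ℚ(z₁,…,zₙ,e^{z₁},…,e^{zₙ})` is at least the dimension of the `ℚ`-vector
space spanned by `z₁,…,zₙ`. -/
def SchanuelConjecture : Prop :=
  ∀ (n : ℕ) (z : Fin n → ℂ),
    TrdegGe ℚ (Set.range z ∪ Set.range fun i => exp (z i))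
      (Module.finrank ℚ ↥(Submodule.span ℚ (Set.range z)))

section Dimension

variable {σ : Type}

theorem isPrime_vanishingIdeal_of_isZIrreducible {V : Set (σ → ℂ)} (hV : IsZIrreducible V) :
    (vanishingIdeal ℂ V).IsPrime := by
  refine ⟨?_, ?_⟩
  · intro h
    obtain ⟨v, hv⟩ := hV.1
    have : (1 : MvPolynomial σ ℂ) ∈ vanishingIdeal ℂ V := h ▸ Submodule.mem_top
    simpa using this v hv
  · intro p q hpq
    have := hV.2 (zeroSet {p}) (zeroSet {q}) ⟨_, rfl⟩ ⟨_, rfl⟩ (by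
      intro v hv
      have h := hpq v hv
      simp only [map_mul, mul_eq_zero] at h
      simpa [zeroSet, aeval_eq_eval] using h)
    refine this.imp (fun h v hv => ?_) (fun h v hv => ?_) <;>
    · have := h hv
      simpa [zeroSet, aeval_eq_eval] using this

theorem zeroLocus_isZIrreducible [Finite σ] (P : Ideal (MvPolynomial σ ℂ)) [hP : P.IsPrime] :
    IsZIrreducible (zeroLocus ℂ P) := by
  have hvan := IsPrime.vanishingIdeal_zeroLocus (K := ℂ) P
  refine ⟨?_, ?_⟩
  · by_contra h
    rw [Set.not_nonempty_iff_eq_empty] at h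
    rw [h, vanishingIdeal_empty] at hvan
    exact hP.ne_top hvan.symm
  · rintro _ _ ⟨T₁, rfl⟩ ⟨T₂, rfl⟩ hc
    by_contra! hcon
    obtain ⟨h1, h2⟩ := hcon
    obtain ⟨x, hx, hx1⟩ := Set.not_subset.1 h1
    obtain ⟨y, hy, hy1⟩ := Set.not_subset.1 h2
    simp only [zeroSet, Set.mem_ofPred_eq, not_forall] at hx1 hy1
    obtain ⟨p, hp, hpx⟩ := hx1
    obtain ⟨q, hq, hqy⟩ := hy1
    have : p * q ∈ vanishingIdeal ℂ (zeroLocus ℂ P) := by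
      intro z hz
      rcases hc hz with h | h
      · simp [aeval_eq_eval, h p hp]
      · simp [aeval_eq_eval, h q hq]
    rw [hvan] at this
    rcases hP.mem_or_mem this with h | h
    · exact hpx (by simpa [aeval_eq_eval] using hx p h)
    · exact hqy (by simpa [aeval_eq_eval] using hy q h)

theorem ringKrullDim_quotient_vanishingIdeal_le_zdim [Finite σ] (V : Set (σ → ℂ)) :
    ringKrullDim (MvPolynomial σ ℂ ⧸ vanishingIdeal ℂ V) ≤ zdim V := by
  set I := vanishingIdeal ℂ V
  have key : ∀ q : PrimeSpectrum (MvPolynomial σ ℂ ⧸ I),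
      IsZClosed (zeroLocus ℂ (q.asIdeal.comap (Ideal.Quotient.mk I))) ∧
      IsZIrreducible (zeroLocus ℂ (q.asIdeal.comap (Ideal.Quotient.mk I))) ∧
      zeroLocus ℂ (q.asIdeal.comap (Ideal.Quotient.mk I)) ⊆ zClosure V := by
    intro q
    refine ⟨⟨(q.asIdeal.comap (Ideal.Quotient.mk I) : Set _), ?_⟩,
      zeroLocus_isZIrreducible _, ?_⟩
    · ext x
      simp [zeroSet, aeval_eq_eval]
    · rintro x hx _ ⟨⟨T, rfl⟩, hT⟩ p hp
      have hpI : p ∈ I := fun v hv => by simpa [aeval_eq_eval] using hT hv p hp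
      have := hx p (by
        rw [Ideal.mem_comap, Ideal.Quotient.eq_zero_iff_mem.2 hpI]; exact zero_mem _)
      simpa [aeval_eq_eval] using this
  rw [ringKrullDim, ← Order.krullDim_orderDual]
  refine Order.krullDim_le_of_strictMono (fun q => ⟨_, key (OrderDual.ofDual q)⟩) ?_
  intro q r hqr
  have hqr' : (OrderDual.ofDual r).asIdeal < (OrderDual.ofDual q).asIdeal := hqr
  have hle : (OrderDual.ofDual r).asIdeal.comap (Ideal.Quotient.mk I) ≤
    (OrderDual.ofDual q).asIdeal.comap (Ideal.Quotient.mk I) := Ideal.comap_mono hqr'.le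
  refine lt_of_le_of_ne (zeroLocus_anti_mono hle) ?_
  intro h
  have h' := congrArg (vanishingIdeal ℂ) (Subtype.ext_iff.1 h)
  simp only [IsPrime.vanishingIdeal_zeroLocus] at h'
  exact hqr'.ne (Ideal.comap_injective_of_surjective _ Ideal.Quotient.mk_surjective h').symm

end Dimension

theorem AlgebraicIndependent.natCard_le_ringKrullDim {k A ι : Type} [Field k] [CommRing A]
    [IsDomain A] [Algebra k A] [Algebra.FiniteType k A] [Finite ι] {x : ι → A}
    (hx : AlgebraicIndependent k x) : (Nat.card ι : WithBot ℕ∞) ≤ ringKrullDim A := by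
  obtain ⟨s, g, hginj, hgint⟩ := exists_integral_inj_algHom_of_fg k A
  have hcard : Nat.card ι ≤ s := by
    let y : Fin s → A := fun i => g (X i)
    have hy : AlgebraicIndependent k y := by
      have := (algebraicIndependent_X (Fin s) k).map' hginj
      exact this
    have hyb : IsTranscendenceBasis k y := by
      rw [hy.isTranscendenceBasis_iff_isAlgebraic]
      refine ⟨fun a => ?_⟩
      have ha : g.toRingHom.IsIntegralElem a := hgint a
      obtain ⟨p, hp, hpa⟩ := ha
      have hmem : ∀ q : MvPolynomial (Fin s) k, g q ∈ Algebra.adjoin k (Set.range y) := by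
        intro q
        rw [Algebra.adjoin_range_eq_range_aeval]
        exact ⟨q, by
          have : aeval y = g := by ext i; simp [y]
          simp [this]⟩
      let φ : MvPolynomial (Fin s) k →+* Algebra.adjoin k (Set.range y) :=
        (g : MvPolynomial (Fin s) k →+* A).codRestrict _ hmem
      refine IsIntegral.isAlgebraic ⟨p.map φ, hp.map _, ?_⟩
      rw [Polynomial.eval₂_map]
      exact hpa
    have h1 := hx.lift_cardinalMk_le_trdeg
    rw [← hyb.lift_cardinalMk_eq_trdeg] at h1
    simp at h1
    have := Fintype.ofFinite ι
    simpa using h1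
  algebraize [g.toRingHom]
  have hd : ringKrullDim (MvPolynomial (Fin s) k) = s := by
    rw [MvPolynomial.ringKrullDim_of_isNoetherianRing]; simp
  obtain ⟨l, hl⟩ := Order.le_krullDim_iff.1 hd.ge
  have : FaithfulSMul (MvPolynomial (Fin s) k) A :=
    (faithfulSMul_iff_algebraMap_injective _ _).2 hginj
  obtain ⟨Q, hQp, hQ⟩ := Ideal.exists_ideal_over_prime_of_isIntegral_of_isDomain (S := A)
    l.head.asIdeal (by
      rw [(RingHom.injective_iff_ker_eq_bot _).1
        (show Function.Injective (algebraMap (MvPolynomial (Fin s) k) A) from hginj)]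
      exact bot_le)
  have : Q.LiesOver l.head.asIdeal := ⟨hQ.symm⟩
  obtain ⟨L, hL, -⟩ := Ideal.exists_ltSeries_of_hasGoingUp l Q
  calc (Nat.card ι : WithBot ℕ∞) ≤ (s : WithBot ℕ∞) := by exact_mod_cast hcard
    _ = L.length := by rw [hL, hl]
    _ ≤ _ := Order.LTSeries.length_le_krullDim L

section Descent

variable {K L σ ι : Type} [Field K] [Field L] [Algebra K L]

/-- Apply a linear form to every coefficient of a polynomial. -/
noncomputable def mapCoeffs (φ : L →ₗ[K] K) (p : MvPolynomial σ L) : MvPolynomial σ K :=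
  ∑ m ∈ p.support, monomial m (φ (coeff m p))

theorem coeff_mapCoeffs (φ : L →ₗ[K] K) (p : MvPolynomial σ L) (m : σ →₀ ℕ) :
    coeff m (mapCoeffs φ p) = φ (coeff m p) := by
  classical
  simp only [mapCoeffs, coeff_sum, coeff_monomial, Finset.sum_ite_eq', mem_support_iff]
  split_ifs with h
  · rfl
  · rw [not_not.1 h, map_zero]

theorem mapCoeffs_add (φ : L →ₗ[K] K) (p q : MvPolynomial σ L) :
    mapCoeffs φ (p + q) = mapCoeffs φ p + mapCoeffs φ q := by
  ext m
  simp [coeff_mapCoeffs]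

theorem mapCoeffs_zero (φ : L →ₗ[K] K) : mapCoeffs φ (0 : MvPolynomial σ L) = 0 := by
  ext m
  simp [coeff_mapCoeffs]

theorem mapCoeffs_mul_map (φ : L →ₗ[K] K) (p : MvPolynomial σ L) (q : MvPolynomial σ K) :
    mapCoeffs φ (p * map (algebraMap K L) q) = mapCoeffs φ p * q := by
  classical
  ext m
  simp only [coeff_mapCoeffs, coeff_mul, map_sum, coeff_map]
  refine Finset.sum_congr rfl fun x _ => ?_
  rw [mul_comm (coeff x.1 p), ← Algebra.smul_def, map_smul, smul_eq_mul, mul_comm]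

theorem mapCoeffs_rename (φ : L →ₗ[K] K) (z : ι → σ) (p : MvPolynomial ι L) :
    mapCoeffs φ (rename z p) = rename z (mapCoeffs φ p) := by
  classical
  have hmon : ∀ {τ : Type} (m : τ →₀ ℕ) (c : L),
      mapCoeffs φ (monomial m c) = monomial m (φ c) := by
    intro τ m c
    ext m'
    rw [coeff_mapCoeffs, coeff_monomial, coeff_monomial]
    split_ifs <;> simp
  induction p using MvPolynomial.induction_on' with
  | monomial m c => simp [rename_monomial, hmon]
  | add p q hp hq => simp [mapCoeffs_add, hp, hq]

theorem exists_rename_mul_mem_span (t : Set (MvPolynomial σ K)) (w : MvPolynomial σ K)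
    (z : ι → σ) {f : MvPolynomial ι L} (hf : f ≠ 0)
    (h : rename z f * map (algebraMap K L) w ∈ Ideal.span (map (algebraMap K L) '' t)) :
    ∃ g : MvPolynomial ι K, g ≠ 0 ∧ rename z g * w ∈ Ideal.span t := by
  obtain ⟨m, hm⟩ := ne_zero_iff.1 hf
  obtain ⟨φ, hφ⟩ := (Algebra.linearMap K L).exists_leftInverse_of_injective
    (LinearMap.ker_eq_bot.2 (algebraMap K L).injective)
  have hφ1 : φ 1 = 1 := by simpa using LinearMap.congr_fun hφ 1
  have hspan : ∀ p ∈ Ideal.span (map (algebraMap K L) '' t),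
      mapCoeffs φ p ∈ Ideal.span t := by
    intro p hp
    induction hp using Submodule.closure_induction with
    | zero => rw [mapCoeffs_zero]; exact zero_mem _
    | add p q _ _ hp hq => rw [mapCoeffs_add]; exact add_mem hp hq
    | smul_mem a x hx =>
      obtain ⟨y, hy, rfl⟩ := hx
      rw [smul_eq_mul, mapCoeffs_mul_map]
      exact Ideal.mul_mem_left _ _ (Ideal.subset_span hy)
  refine ⟨mapCoeffs φ (C (coeff m f)⁻¹ * f), ?_, ?_⟩
  · refine ne_zero_iff.2 ⟨m, ?_⟩
    rw [coeff_mapCoeffs, coeff_C_mul, inv_mul_cancel₀ hm, hφ1]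
    exact one_ne_zero
  · rw [← mapCoeffs_rename, ← mapCoeffs_mul_map]
    apply hspan
    rw [map_mul, mul_assoc]
    exact Ideal.mul_mem_left _ _ h

end Descent

theorem exists_rational_relation {σ ι : Type} [Finite σ] [Finite ι] {V : Set (σ → ℂ)}
    {T : Set (MvPolynomial σ ℂ)} (w : MvPolynomial σ ℚ)
    (hTalg : ∀ p ∈ T, ∀ m, IsAlgebraic ℚ (MvPolynomial.coeff m p))
    (hV : V = zeroSet T ∩ {v | aeval v w ≠ 0}) (hVirr : IsZIrreducible V)
    (hVdim : zdim V < Nat.card ι) (z : ι → σ) :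
    ∃ R : MvPolynomial ι ℚ, R ≠ 0 ∧ ∀ v ∈ V, aeval (v ∘ z) R = 0 := by
  set I := vanishingIdeal ℂ V
  have hI : I.IsPrime := isPrime_vanishingIdeal_of_isZIrreducible hVirr
  have hdep : ¬ AlgebraicIndependent ℂ fun i => Ideal.Quotient.mk I (X (z i)) := fun h =>
    absurd (h.natCard_le_ringKrullDim.trans (ringKrullDim_quotient_vanishingIdeal_le_zdim V))
      (not_le.2 hVdim)
  rw [algebraicIndependent_iff] at hdep
  push Not at hdep
  obtain ⟨f, hf, hf0⟩ := hdep
  have hfI : rename z f ∈ I := by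
    rw [← Ideal.Quotient.eq_zero_iff_mem, ← hf]
    have : (Ideal.Quotient.mkₐ ℂ I).comp (rename z) =
        aeval (fun i => Ideal.Quotient.mk I (X (z i))) := by
      ext i; simp
    exact DFunLike.congr_fun this f
  let K := algebraicClosure ℚ ℂ
  let t : Set (MvPolynomial σ K) := map (algebraMap K ℂ) ⁻¹' T
  have hT : map (algebraMap K ℂ) '' t = T := by
    refine Set.image_preimage_eq_of_subset fun p hp => ?_
    rw [← RingHom.coe_range, SetLike.mem_coe, RingHom.mem_range, ← Set.mem_range,
      mem_range_map_iff_coeffs_subset]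
    intro c hc
    obtain ⟨m, -, rfl⟩ := mem_coeffs_iff.1 hc
    exact ⟨⟨_, mem_algebraicClosure_iff.2 (hTalg p hp m)⟩, rfl⟩
  let w' : MvPolynomial σ K := map (algebraMap ℚ K) w
  have hw' : map (algebraMap K ℂ) w' = map (algebraMap ℚ ℂ) w := by
    rw [map_map]; rfl
  have hw : ∀ v : σ → ℂ, aeval v w = eval v (map (algebraMap ℚ ℂ) w) := fun v => by
    rw [eval_map, aeval_def]
  have hrad : rename z f * map (algebraMap ℚ ℂ) w ∈ (Ideal.span T).radical := by
    rw [← vanishingIdeal_zeroLocus_eq_radical (K := ℂ), zeroLocus_span]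
    intro v hv
    rw [map_mul, mul_eq_zero, or_iff_not_imp_right]
    intro hvw
    refine hfI v ?_
    rw [hV]
    refine ⟨fun p hp => by simpa [aeval_eq_eval] using hv p hp, ?_⟩
    simpa [hw, aeval_eq_eval] using hvw
  obtain ⟨k, hk⟩ := hrad
  rw [mul_pow, ← map_pow, ← hw', ← map_pow, ← hT] at hk
  obtain ⟨g, hg0, hg⟩ := exists_rename_mul_mem_span t (w' ^ k) z (pow_ne_zero k hf0) hk
  have hgV : ∀ v ∈ V, aeval (v ∘ z) g = 0 := by
    intro v hv
    have hker : Ideal.span t ≤ RingHom.ker (aeval (R := K) v) := by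
      refine Ideal.span_le.2 fun p hp => ?_
      have := (hV ▸ hv).1 _ hp
      rw [eval_map] at this
      exact this
    have := hker hg
    rw [RingHom.mem_ker, map_mul, mul_eq_zero, aeval_rename] at this
    refine this.resolve_right ?_
    rw [map_pow]
    refine pow_ne_zero _ ?_
    have h2 := (hV ▸ hv).2
    rwa [Set.mem_ofPred_eq, hw, ← hw', eval_map] at h2
  have : Algebra.IsAlgebraic ℚ K := algebraicClosure.isAlgebraic ℚ ℂ
  obtain ⟨R, hR0, hR⟩ := exists_dvd_map_of_isAlgebraic (R := ℚ) hg0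
  refine ⟨R, hR0, fun v hv => ?_⟩
  have h := map_dvd (aeval (R := K) (v ∘ z)) hR
  rw [hgV v hv, zero_dvd_iff] at h
  rw [← h, aeval_def, aeval_def, eval₂_map]
  rfl

section PrimitiveElement

open scoped IntermediateField

variable {R K : Type} [CommRing R] [IsDomain R] [Field K] [Algebra R K]

theorem exists_smul_eq_aeval_of_mem_adjoin {k : Type} [Field k] [Algebra R k] [IsFractionRing R k]
    [Algebra k K] [IsScalarTower R k K] {θ e : K} (hθ : IsIntegral k θ) (he : e ∈ k⟮θ⟯) :
    ∃ d : R, d ≠ 0 ∧ ∃ G : Polynomial R, d • e = Polynomial.aeval θ G := by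
  rw [← IntermediateField.mem_toSubalgebra,
    IntermediateField.adjoin_simple_toSubalgebra_of_isAlgebraic hθ.isAlgebraic,
    Algebra.adjoin_singleton_eq_range_aeval] at he
  obtain ⟨p, rfl⟩ := he
  obtain ⟨d, hd, h⟩ := IsLocalization.integerNormalization_spec (nonZeroDivisors R) p
  refine ⟨d, nonZeroDivisors.ne_zero hd,
    IsLocalization.integerNormalization (nonZeroDivisors R) p, ?_⟩
  rw [← Polynomial.aeval_map_algebraMap k, h]
  simp [Algebra.smul_def, IsScalarTower.algebraMap_apply R k K,
    IsScalarTower.algebraMap_apply R k (Polynomial k)]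

theorem exists_integral_primitive_element [CharZero R] [FaithfulSMul R K]
    {ι : Type} [Finite ι] (y : ι → K)
    (hy : ∀ i, IsAlgebraic R (y i)) :
    ∃ θ : K, IsIntegral R θ ∧
      (∀ i, ∃ d : R, d ≠ 0 ∧ ∃ G : Polynomial R, d • y i = Polynomial.aeval θ G) ∧
      (∀ i, ∃ d : R, d ≠ 0 ∧ ∃ H : Polynomial R, d • (y i)⁻¹ = Polynomial.aeval θ H) := by
  let k := FractionRing R
  let _ : Algebra k K := FractionRing.liftAlgebra R K
  have hyk : ∀ i, IsIntegral k (y i) := fun i => 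
    ((IsFractionRing.isAlgebraic_iff R k K).1 (hy i)).isIntegral
  let E := IntermediateField.adjoin k (Set.range y)
  have : FiniteDimensional k E := IntermediateField.finiteDimensional_adjoin
    (by rintro _ ⟨i, rfl⟩; exact hyk i)
  have : CharZero k := charZero_of_injective_algebraMap (IsFractionRing.injective R k)
  obtain ⟨α, hα⟩ := Field.exists_primitive_element k E
  have hαK : k⟮(α : K)⟯ = E := by
    rw [← IntermediateField.lift_adjoin_simple, hα, IntermediateField.lift_top]
  have halg : IsAlgebraic R (α : K) := by
    have h : IsAlgebraic k (α : K) := (IsIntegral.of_finite k α).isAlgebraic.algebraMap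
    exact (IsFractionRing.isAlgebraic_iff R k K).2 h
  obtain ⟨c, hc, hint⟩ := halg.exists_integral_multiple
  have hle : E ≤ k⟮c • (α : K)⟯ := by
    refine hαK.ge.trans ?_
    rw [IntermediateField.adjoin_simple_le_iff]
    have hc' : algebraMap R k c ≠ 0 := by
      simpa using hc
    have hα' : (algebraMap R k c)⁻¹ • (c • (α : K)) = α := by
      rw [← IsScalarTower.algebraMap_smul k c (α : K), inv_smul_smul₀ hc']
    have := IntermediateField.smul_mem _ (x := (algebraMap R k c)⁻¹)
      (IntermediateField.mem_adjoin_simple_self k (c • (α : K)))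
    rwa [hα'] at this
  have hyE : ∀ i, y i ∈ E := fun i => IntermediateField.subset_adjoin _ _ ⟨i, rfl⟩
  exact ⟨c • α, hint, fun i => exists_smul_eq_aeval_of_mem_adjoin hint.tower_top (hle (hyE i)),
    fun i => exists_smul_eq_aeval_of_mem_adjoin hint.tower_top (hle (inv_mem (hyE i)))⟩

theorem exists_bezout_minpoly [CharZero R] [IsIntegrallyClosed R] [FaithfulSMul R K]
    {θ : K} (hθ : IsIntegral R θ) :
    ∃ d : R, d ≠ 0 ∧ ∃ S W : Polynomial R,
      minpoly R θ * S + (minpoly R θ).derivative * W = Polynomial.C d := by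
  let k := FractionRing R
  let _ : Algebra k K := FractionRing.liftAlgebra R K
  have : CharZero k := charZero_of_injective_algebraMap (IsFractionRing.injective R k)
  have hsep : (minpoly k θ).Separable := (minpoly.irreducible hθ.tower_top).separable
  rw [minpoly.isIntegrallyClosed_eq_field_fractions' k hθ] at hsep
  obtain ⟨a, b, hab⟩ := hsep
  obtain ⟨d, hd, h⟩ := IsLocalization.integerNormalization_spec (nonZeroDivisors R) a
  obtain ⟨e, he, h'⟩ := IsLocalization.integerNormalization_spec (nonZeroDivisors R) b
  refine ⟨d * e, nonZeroDivisors.ne_zero (mul_mem hd he),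
    Polynomial.C e * IsLocalization.integerNormalization (nonZeroDivisors R) a,
    Polynomial.C d * IsLocalization.integerNormalization (nonZeroDivisors R) b, ?_⟩
  apply Polynomial.map_injective _ (IsFractionRing.injective R k)
  simp only [Polynomial.map_add, Polynomial.map_mul, h, h', Polynomial.map_C,
    ← Polynomial.derivative_map]
  have hs : ∀ (r : R) (p : Polynomial k), r • p = Polynomial.C (algebraMap R k r) * p := by
    intro r p
    rw [← Polynomial.smul_eq_C_mul, algebraMap_smul]
  rw [hs, hs, map_mul, Polynomial.C_mul]
  linear_combination (Polynomial.C (algebraMap R k d) * Polynomial.C (algebraMap R k e)) * hab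

end PrimitiveElement

/-- Evaluate a polynomial in `Y` over `ℂ[x]` at a point `(x, θ)`. -/
noncomputable def evalPair {τ : Type} (x : τ → ℂ) (θ : ℂ) :
    Polynomial (MvPolynomial τ ℂ) →+* ℂ :=
  Polynomial.eval₂RingHom (eval x) θ

@[simp]
theorem evalPair_C {τ : Type} (x : τ → ℂ) (θ : ℂ) (p : MvPolynomial τ ℂ) :
    evalPair x θ (Polynomial.C p) = eval x p := by
  simp [evalPair]

theorem exists_smul_of_dvd {R K : Type} [CommRing R] [CommRing K] [Algebra R K] {d D : R} {e θ : K}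
    (hdD : d ∣ D) (h : ∃ G : Polynomial R, d • e = Polynomial.aeval θ G) :
    ∃ G : Polynomial R, D • e = Polynomial.aeval θ G := by
  obtain ⟨c, rfl⟩ := hdD
  obtain ⟨G, hG⟩ := h
  exact ⟨c • G, by rw [map_smul, ← hG, smul_smul, mul_comm]⟩

theorem exists_evalPair_eq {τ ι K : Type} [Field K] [Algebra (MvPolynomial τ ℂ) K]
    (ψ : MvPolynomial (τ ⊕ ι) ℂ →+* K)
    (hψ : ∀ p : MvPolynomial τ ℂ, ψ (rename Sum.inl p) = algebraMap _ K p)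
    (D : MvPolynomial τ ℂ) (θ : K) (G : ι → Polynomial (MvPolynomial τ ℂ))
    (hG : ∀ i, D • ψ (X (Sum.inr i)) = Polynomial.aeval θ (G i)) (p : MvPolynomial (τ ⊕ ι) ℂ) :
    ∃ (N : ℕ) (P : Polynomial (MvPolynomial τ ℂ)), Polynomial.aeval θ P = D ^ N • ψ p ∧
      ∀ (x : τ → ℂ) (t : ℂ), eval x D ≠ 0 → evalPair x t P =
        eval x D ^ N * eval (Sum.elim x fun i => evalPair x t (G i) / eval x D) p := by
  induction p using MvPolynomial.induction_on with
  | C a =>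
    refine ⟨0, Polynomial.C (C a), ?_, fun x t _ => by simp⟩
    rw [Polynomial.aeval_C, ← hψ]
    simp
  | add p q hp hq =>
    obtain ⟨N, P, hP, hP'⟩ := hp
    obtain ⟨M, Q, hQ, hQ'⟩ := hq
    refine ⟨N + M, D ^ M • P + D ^ N • Q, ?_, fun x t hx => ?_⟩
    · rw [map_add (Polynomial.aeval θ), map_smul, map_smul, hP, hQ, map_add ψ]
      simp only [Algebra.smul_def, map_pow]
      ring
    · simp only [Polynomial.smul_eq_C_mul, map_add, map_mul, evalPair_C, map_pow, hP' x t hx,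
        hQ' x t hx]
      ring
  | mul_X p i hp =>
    obtain ⟨N, P, hP, hP'⟩ := hp
    cases i with
    | inl i =>
      refine ⟨N, (X i : MvPolynomial τ ℂ) • P, ?_, fun x t hx => ?_⟩
      · rw [map_smul, hP, map_mul, ← rename_X (R := ℂ) Sum.inl, hψ]
        simp only [Algebra.smul_def, map_pow]
        ring
      · simp only [Polynomial.smul_eq_C_mul, map_mul, evalPair_C, hP' x t hx, eval_X, Sum.elim_inl]
        ring
    | inr i =>
      refine ⟨N + 1, P * G i, ?_, fun x t hx => ?_⟩
      · rw [map_mul, hP, ← hG, map_mul]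
        simp only [Algebra.smul_def, map_pow]
        ring
      · simp only [map_mul, hP' x t hx, eval_X, Sum.elim_inr]
        field_simp
        ring

theorem exists_parametrization {τ ι K : Type} [Finite ι] [Field K]
    [Algebra (MvPolynomial τ ℂ) K] [FaithfulSMul (MvPolynomial τ ℂ) K]
    (ψ : MvPolynomial (τ ⊕ ι) ℂ →+* K)
    (hψ : ∀ p : MvPolynomial τ ℂ, ψ (rename Sum.inl p) = algebraMap _ K p)
    (halg : ∀ i, IsAlgebraic (MvPolynomial τ ℂ) (ψ (X (Sum.inr i))))
    (hy : ∀ i, ψ (X (Sum.inr i)) ≠ 0) {w : MvPolynomial (τ ⊕ ι) ℂ} (hw : ψ w ≠ 0) :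
    ∃ (F S W : Polynomial (MvPolynomial τ ℂ)) (D : MvPolynomial τ ℂ)
      (G H : ι → Polynomial (MvPolynomial τ ℂ)),
      F.Monic ∧ 0 < F.natDegree ∧ D ≠ 0 ∧ F * S + F.derivative * W = Polynomial.C D ∧
      (∀ i, F ∣ G i * H i - Polynomial.C (D ^ 2)) ∧
      ∀ (x : τ → ℂ) (t : ℂ), eval x D ≠ 0 → evalPair x t F = 0 →
        (∀ p, ψ p = 0 → eval (Sum.elim x fun i => evalPair x t (G i) / eval x D) p = 0) ∧
        eval (Sum.elim x fun i => evalPair x t (G i) / eval x D) w ≠ 0 := by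
  classical
  have := Fintype.ofFinite ι
  let r : (MvPolynomial τ ℂ) →+* MvPolynomial (τ ⊕ ι) ℂ := (rename Sum.inl : _ →ₐ[ℂ] _).toRingHom
  have hr : algebraMap (MvPolynomial τ ℂ) K = ψ.comp r := RingHom.ext fun p => (hψ p).symm
  have hwalg : IsAlgebraic (MvPolynomial τ ℂ) (ψ w) := by
    clear hw
    induction w using MvPolynomial.induction_on with
    | C a =>
      rw [← rename_C (R := ℂ) Sum.inl, hψ]
      exact isAlgebraic_algebraMap _
    | add p q hp hq =>
      rw [map_add]
      exact hp.add hq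
    | mul_X p i hp =>
      rw [map_mul]
      refine hp.mul ?_
      cases i with
      | inl i =>
        rw [← rename_X (R := ℂ) Sum.inl, hψ]
        exact isAlgebraic_algebraMap _
      | inr i => exact halg i
  obtain ⟨q, hq0, hq⟩ := hwalg.exists_nonzero_coeff_and_aeval_eq_zero
    (mem_nonZeroDivisors_of_ne_zero hw)
  obtain ⟨θ, hθ, hG, hH⟩ := exists_integral_primitive_element _ halg
  choose d hd hG using hG
  choose d' hd' hH using hH
  obtain ⟨e, he, S, W, hSW⟩ := exists_bezout_minpoly hθ
  let D : MvPolynomial τ ℂ := q.coeff 0 * (e * ((∏ i, d i) * ∏ i, d' i))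
  have hD : D ≠ 0 := mul_ne_zero hq0 (mul_ne_zero he (mul_ne_zero
    (Finset.prod_ne_zero_iff.2 fun i _ => hd i) (Finset.prod_ne_zero_iff.2 fun i _ => hd' i)))
  obtain ⟨c, hc⟩ : e ∣ D := (dvd_mul_right e _).mul_left _
  have hG' : ∀ i, ∃ G : Polynomial (MvPolynomial τ ℂ), D • ψ (X (Sum.inr i)) = Polynomial.aeval θ G := fun i =>
    exists_smul_of_dvd (((Finset.dvd_prod_of_mem d (Finset.mem_univ i)).mul_right _ |>.mul_left
      _).mul_left _) (hG i)
  have hH' : ∀ i, ∃ H : Polynomial (MvPolynomial τ ℂ), D • (ψ (X (Sum.inr i)))⁻¹ = Polynomial.aeval θ H := fun i =>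
    exists_smul_of_dvd (((Finset.dvd_prod_of_mem d' (Finset.mem_univ i)).mul_left _ |>.mul_left
      _).mul_left _) (hH i)
  choose G hG' using hG'
  choose H hH' using hH'
  refine ⟨minpoly (MvPolynomial τ ℂ) θ, Polynomial.C c * S, Polynomial.C c * W, D, G, H, minpoly.monic hθ,
    minpoly.natDegree_pos hθ, hD, ?_, fun i => ?_, fun x t hx ht => ?_⟩
  · rw [hc, mul_comm e, Polynomial.C_mul, ← hSW]
    ring
  · apply minpoly.isIntegrallyClosed_dvd hθ
    rw [map_sub, map_mul, ← hG', ← hH', Polynomial.aeval_C, sub_eq_zero, Algebra.smul_def,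
      Algebra.smul_def, map_pow]
    have := hy i
    field_simp
  · set v : τ ⊕ ι → ℂ := Sum.elim x fun i => evalPair x t (G i) / eval x D with hv
    have hI : ∀ p, ψ p = 0 → eval v p = 0 := by
      intro p hp
      obtain ⟨N, P, hP, hP'⟩ := exists_evalPair_eq ψ hψ D θ G hG' p
      rw [hp, smul_zero] at hP
      have h := map_dvd (evalPair x t) (minpoly.isIntegrallyClosed_dvd hθ hP)
      rw [ht, zero_dvd_iff, hP' x t hx] at h
      exact (mul_eq_zero.1 h).resolve_left (pow_ne_zero _ hx)
    refine ⟨hI, fun hwv => ?_⟩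
    have h : ψ (q.eval₂ r w) = 0 := by
      rw [Polynomial.hom_eval₂, ← hr]
      exact hq
    have h0 := hI _ h
    rw [Polynomial.hom_eval₂, hwv, Polynomial.eval₂_at_zero] at h0
    refine hx ?_
    have hrv : (eval v).comp r = eval x := by
      ext i <;> simp [r, hv]
    rw [map_mul, ← hrv, h0, zero_mul]

section Growth

variable {τ : Type} [Fintype τ]

theorem MvPolynomial.exists_norm_eval_le (p : MvPolynomial τ ℂ) :
    ∃ A : ℝ, 0 ≤ A ∧ ∃ m : ℕ, ∀ x : τ → ℂ, ‖eval x p‖ ≤ A * (1 + ‖x‖) ^ m := by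
  induction p using MvPolynomial.induction_on with
  | C a => exact ⟨‖a‖, norm_nonneg _, 0, fun x => by simp⟩
  | add p q hp hq =>
    obtain ⟨A, hA, m, h⟩ := hp
    obtain ⟨B, hB, k, h'⟩ := hq
    refine ⟨A + B, by positivity, m + k, fun x => ?_⟩
    have h1 : (1 : ℝ) ≤ 1 + ‖x‖ := by linarith [norm_nonneg x]
    calc ‖eval x (p + q)‖ ≤ ‖eval x p‖ + ‖eval x q‖ := by
          rw [map_add]; exact norm_add_le _ _
      _ ≤ A * (1 + ‖x‖) ^ m + B * (1 + ‖x‖) ^ k := add_le_add (h x) (h' x)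
      _ ≤ A * (1 + ‖x‖) ^ (m + k) + B * (1 + ‖x‖) ^ (m + k) := by
          gcongr <;> first | exact h1 | omega
      _ = _ := by ring
  | mul_X p i hp =>
    obtain ⟨A, hA, m, h⟩ := hp
    refine ⟨A, hA, m + 1, fun x => ?_⟩
    rw [map_mul, eval_X, norm_mul, pow_succ, ← mul_assoc]
    refine mul_le_mul (h x) ?_ (norm_nonneg _) (by positivity)
    linarith [norm_le_pi_norm x i]

theorem exists_norm_root_le {F : Polynomial (MvPolynomial τ ℂ)} (hF : F.Monic) :
    ∃ A : ℝ, 0 ≤ A ∧ ∃ m : ℕ, ∀ (x : τ → ℂ) (t : ℂ), evalPair x t F = 0 →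
      ‖t‖ ≤ A * (1 + ‖x‖) ^ m := by
  choose A hA m hm using fun j => (F.coeff j).exists_norm_eval_le
  refine ⟨1 + ∑ j ∈ Finset.range F.natDegree, A j, ?_,
    ∑ j ∈ Finset.range F.natDegree, m j, fun x t ht => ?_⟩
  · have := Finset.sum_nonneg fun j (_ : j ∈ Finset.range F.natDegree) => hA j
    positivity
  have h1 : (1 : ℝ) ≤ 1 + ‖x‖ := by linarith [norm_nonneg x]
  have hmon := hF.map (eval x)
  have hroot : (F.map (eval x)).IsRoot t := by
    rw [Polynomial.IsRoot.def, Polynomial.eval_map]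
    exact ht
  have hlt := Polynomial.IsRoot.norm_lt_cauchyBound hmon.ne_zero hroot
  have hb : ((F.map (eval x)).cauchyBound : ℝ) ≤
      1 + ∑ j ∈ Finset.range F.natDegree, A j * (1 + ‖x‖) ^ m j := by
    rw [Polynomial.cauchyBound, hmon.leadingCoeff, nnnorm_one, div_one, hF.natDegree_map,
      NNReal.coe_add, NNReal.coe_one, add_comm, add_le_add_iff_left]
    have hnn : ∀ j ∈ Finset.range F.natDegree, 0 ≤ A j * (1 + ‖x‖) ^ m j :=
      fun j _ => mul_nonneg (hA j) (by positivity)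
    rw [← Real.le_toNNReal_iff_coe_le (Finset.sum_nonneg hnn)]
    refine Finset.sup_le fun j hj => ?_
    rw [Real.le_toNNReal_iff_coe_le (Finset.sum_nonneg hnn), Polynomial.coeff_map, coe_nnnorm]
    exact (hm j x).trans (Finset.single_le_sum (f := fun j => A j * (1 + ‖x‖) ^ m j) hnn hj)
  refine (show ‖t‖ ≤ _ from by exact_mod_cast hlt.le).trans (hb.trans ?_)
  rw [add_mul, one_mul, Finset.sum_mul]
  refine add_le_add (one_le_pow₀ h1) (Finset.sum_le_sum fun j hj => ?_)
  exact mul_le_mul_of_nonneg_left (pow_le_pow_right₀ h1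
    (Finset.single_le_sum (fun _ _ => Nat.zero_le _) hj)) (hA j)

theorem exists_norm_evalPair_le {F : Polynomial (MvPolynomial τ ℂ)} (hF : F.Monic)
    (G : Polynomial (MvPolynomial τ ℂ)) :
    ∃ A : ℝ, 0 ≤ A ∧ ∃ m : ℕ, ∀ (x : τ → ℂ) (t : ℂ), evalPair x t F = 0 →
      ‖evalPair x t G‖ ≤ A * (1 + ‖x‖) ^ m := by
  obtain ⟨B, hB, k, hk⟩ := exists_norm_root_le hF
  induction G using Polynomial.induction_on' with
  | add p q hp hq =>
    obtain ⟨A, hA, m, h⟩ := hp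
    obtain ⟨B, hB, k, h'⟩ := hq
    refine ⟨A + B, by positivity, m + k, fun x t ht => ?_⟩
    have h1 : (1 : ℝ) ≤ 1 + ‖x‖ := by linarith [norm_nonneg x]
    calc ‖evalPair x t (p + q)‖ ≤ ‖evalPair x t p‖ + ‖evalPair x t q‖ := by
          rw [map_add]; exact norm_add_le _ _
      _ ≤ A * (1 + ‖x‖) ^ m + B * (1 + ‖x‖) ^ k := add_le_add (h x t ht) (h' x t ht)
      _ ≤ A * (1 + ‖x‖) ^ (m + k) + B * (1 + ‖x‖) ^ (m + k) := by
          gcongr <;> first | exact h1 | omega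
      _ = _ := by ring
  | monomial j a =>
    obtain ⟨A, hA, m, h⟩ := a.exists_norm_eval_le
    refine ⟨A * B ^ j, by positivity, m + k * j, fun x t ht => ?_⟩
    have : evalPair x t (Polynomial.monomial j a) = eval x a * t ^ j := by simp [evalPair]
    rw [this, norm_mul, norm_pow]
    calc ‖eval x a‖ * ‖t‖ ^ j ≤ (A * (1 + ‖x‖) ^ m) * (B * (1 + ‖x‖) ^ k) ^ j := by
          gcongr
          · exact h x
          · exact hk x t ht
      _ = _ := by ring

end Growth

theorem MvPolynomial.exists_degree_eq_totalDegree {σ R : Type*} [CommSemiring R]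
    {p : MvPolynomial σ R} (hp : p ≠ 0) : ∃ m ∈ p.support, m.degree = p.totalDegree := by
  obtain ⟨m, hm, h⟩ := p.support.exists_mem_eq_sup (support_nonempty.2 hp)
    fun s => s.sum fun _ e => e
  exact ⟨m, hm, h.symm⟩

theorem MvPolynomial.IsHomogeneous.eval_smul_apply {σ R : Type*} [CommSemiring R]
    {p : MvPolynomial σ R} {n : ℕ} (hp : p.IsHomogeneous n) (c : R) (x : σ → R) :
    eval (c • x) p = c ^ n * eval x p := by
  simp only [eval_eq, Finset.mul_sum]
  refine Finset.sum_congr rfl fun m hm => ?_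
  have hdeg : ∑ i ∈ m.support, m i = n := by
    rw [← hp (mem_support_iff.1 hm), Finsupp.weight_apply]
    simp [Finsupp.sum]
  simp only [Pi.smul_apply, smul_eq_mul, mul_pow, Finset.prod_mul_distrib,
    Finset.prod_pow_eq_pow_sum, hdeg]
  ring

theorem exists_eval_two_pi_I_mul_ne_zero {τ : Type} {p : MvPolynomial τ ℂ} (hp : p ≠ 0) :
    ∃ k : τ → ℤ, eval (fun i => 2 * Real.pi * I * k i) p ≠ 0 := by
  by_contra! h
  refine hp (funext_set (fun _ => Set.range fun k : ℤ => 2 * Real.pi * I * (k : ℂ))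
    (fun _ => Set.infinite_range_of_injective fun a b hab => ?_) fun x hx => ?_)
  · simpa [Real.pi_ne_zero] using hab
  · choose k hk using fun i => hx i (Set.mem_univ i)
    rw [map_zero, ← h k]
    congr
    ext i
    exact (hk i).symm

/-- A nonzero polynomial is bounded below on balls of linearly growing radius centred along a
ray of points in `2πi ℤ^τ`. -/
theorem exists_forall_le_norm_eval {τ : Type} [Fintype τ] {D : MvPolynomial τ ℂ} (hD : D ≠ 0) :
    ∃ (k : τ → ℤ) (ε c : ℝ) (N₀ : ℕ), 0 < ε ∧ 0 < c ∧ ∀ N : ℕ, N₀ ≤ N → ∀ x : τ → ℂ,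
      x ∈ Metric.ball ((N : ℂ) • fun i => 2 * Real.pi * I * (k i : ℂ)) (ε * N) →
        c ≤ ‖eval x D‖ := by
  classical
  set d := D.totalDegree
  have htop : homogeneousComponent d D ≠ 0 := by
    obtain ⟨m, hm, hmd⟩ := exists_degree_eq_totalDegree hD
    intro h
    have := congrArg (coeff m) h
    rw [coeff_homogeneousComponent, if_pos hmd, coeff_zero] at this
    exact mem_support_iff.1 hm this
  obtain ⟨k, hk⟩ := exists_eval_two_pi_I_mul_ne_zero htop
  set u : τ → ℂ := fun i => 2 * Real.pi * I * (k i : ℂ)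
  let Φ : ℂ × (τ → ℂ) → ℂ := fun q =>
    ∑ j ∈ Finset.range (d + 1), q.1 ^ (d - j) * eval q.2 (homogeneousComponent j D)
  have hΦ : Continuous Φ := by
    refine continuous_finsetSum _ fun j _ => ?_
    exact (continuous_fst.pow _).mul ((MvPolynomial.continuous_eval _).comp continuous_snd)
  have hΦ0 : Φ (0, u) = eval u (homogeneousComponent d D) := by
    simp only [Φ]
    rw [Finset.sum_eq_single d]
    · simp
    · intro j hj hjd
      have : d - j ≠ 0 := by have := Finset.mem_range.1 hj; omega
      simp [this]
    · simp
  have hpos : 0 < ‖Φ (0, u)‖ := by rw [hΦ0]; exact norm_pos_iff.2 hk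
  have hev : ∀ᶠ q in nhds ((0 : ℂ), u), ‖Φ (0, u)‖ / 2 < ‖Φ q‖ :=
    hΦ.norm.continuousAt.eventually_const_lt (half_lt_self hpos)
  obtain ⟨ε, hε, hball⟩ := Metric.eventually_nhds_iff.1 hev
  obtain ⟨N₀, hN₀⟩ := exists_nat_gt (1 / ε)
  refine ⟨k, ε, ‖Φ (0, u)‖ / 2, N₀ + 1, hε, half_pos hpos, fun N hN x hx => ?_⟩
  have hN1 : (1 : ℝ) ≤ N := by exact_mod_cast (by omega : 1 ≤ N)
  have hN0 : (0 : ℝ) < N := by linarith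
  have hNC : (N : ℂ) ≠ 0 := by exact_mod_cast hN0.ne'
  have hNε : 1 / ε < N := hN₀.trans (by exact_mod_cast hN)
  have hxz : x = (N : ℂ) • ((N : ℂ)⁻¹ • x) := by rw [smul_inv_smul₀ hNC]
  set z := (N : ℂ)⁻¹ • x
  have hz : dist z u < ε := by
    rw [Metric.mem_ball, hxz, dist_smul₀] at hx
    simp only [Complex.norm_natCast] at hx
    nlinarith
  have hs : dist ((N : ℂ)⁻¹) 0 < ε := by
    rw [dist_zero_right, norm_inv, Complex.norm_natCast]
    rw [div_lt_iff₀ hε] at hNε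
    rw [inv_lt_iff_one_lt_mul₀ hN0]
    linarith
  have hlt := hball (y := ((N : ℂ)⁻¹, z)) (by
    rw [Prod.dist_eq]; exact max_lt hs hz)
  have hDx : eval x D = (N : ℂ) ^ d * Φ ((N : ℂ)⁻¹, z) := by
    conv_lhs => rw [← D.sum_homogeneousComponent, hxz]
    rw [map_sum, Finset.mul_sum]
    refine Finset.sum_congr rfl fun j hj => ?_
    have hj' : j ≤ d := by have := Finset.mem_range.1 hj; omega
    rw [(homogeneousComponent_isHomogeneous j D).eval_smul_apply]
    obtain ⟨e, he⟩ := Nat.exists_eq_add_of_le hj'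
    rw [he, Nat.add_sub_cancel_left]
    rw [inv_pow, pow_add]
    field_simp
  rw [hDx, norm_mul, norm_pow, Complex.norm_natCast]
  have : (1 : ℝ) ≤ (N : ℝ) ^ d := one_le_pow₀ hN1
  nlinarith [norm_nonneg (Φ ((N : ℂ)⁻¹, z))]

theorem isSimplyConnected_ball {E : Type*} [NormedAddCommGroup E] [NormedSpace ℝ E] (c : E)
    {r : ℝ} (hr : 0 < r) : IsSimplyConnected (Metric.ball c r) :=
  have := (convex_ball c r).contractibleSpace (Metric.nonempty_ball.2 hr)
  inferInstanceAs (SimplyConnectedSpace (Metric.ball c r))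

section Branch

open Topology Filter

variable {E : Type*} [NormedAddCommGroup E] [NormedSpace ℂ E] [CompleteSpace E]

theorem isLocalHomeomorphOn_fst_of_isInvertible {f : E × ℂ → ℂ} {B : Set E}
    (hf : ∀ q : E × ℂ, q.1 ∈ B → f q = 0 → ∃ f' : E × ℂ →L[ℂ] ℂ, HasStrictFDerivAt f f' q ∧
      (f' ∘L .inr ℂ E ℂ).IsInvertible) :
    IsLocalHomeomorphOn (fun q : {q : E × ℂ // f q = 0} => q.1.1) ((fun q => q.1.1) ⁻¹' B) := by
  rw [isLocalHomeomorphOn_iff_isOpenEmbedding_restrict]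
  rintro ⟨q, hq⟩ hqB
  obtain ⟨f', hf', hinv⟩ := hf q hqB hq
  set φ := hf'.implicitFunctionDataOfProdDomain hinv
  set e := φ.toOpenPartialHomeomorph
  have he : ∀ p, e p = (f p, p.1) := fun p => rfl
  have hqe : q ∈ e.source := φ.pt_mem_toOpenPartialHomeomorph_source
  refine ⟨Subtype.val ⁻¹' e.source,
    (e.open_source.preimage continuous_subtype_val).mem_nhds hqe, ?_⟩
  refine .of_continuous_injective_isOpenMap ?_ ?_ ?_
  · exact (continuous_fst.comp continuous_subtype_val).comp continuous_subtype_val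
  · rintro ⟨⟨p, hp⟩, hpe⟩ ⟨⟨p', hp'⟩, hpe'⟩ h
    have h' : p.1 = p'.1 := h
    have : p = p' := e.injOn hpe hpe' (by rw [he, he, hp, hp', h'])
    subst this
    rfl
  · intro W hW
    obtain ⟨W', hW', rfl⟩ := isOpen_induced_iff.1 hW
    obtain ⟨O, hO, rfl⟩ := isOpen_induced_iff.1 hW'
    have hopen : IsOpen (e '' (e.source ∩ O)) :=
      e.isOpen_image_of_subset_source (e.open_source.inter hO) Set.inter_subset_left
    convert hopen.preimage (Continuous.prodMk_right (0 : ℂ) : Continuous fun x : E => ((0 : ℂ), x))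
      using 1
    ext x
    constructor
    · rintro ⟨⟨⟨p, hp⟩, hpe⟩, hpO, rfl⟩
      exact ⟨p, ⟨hpe, hpO⟩, by rw [he, hp]; rfl⟩
    · rintro ⟨p, ⟨hpe, hpO⟩, h⟩
      rw [he, Prod.mk.injEq] at h
      exact ⟨⟨⟨p, h.1⟩, hpe⟩, hpO, h.2⟩

theorem differentiableOn_of_isInvertible {f : E × ℂ → ℂ} {B : Set E} (hB : IsOpen B)
    (hf : ∀ q : E × ℂ, q.1 ∈ B → f q = 0 → ∃ f' : E × ℂ →L[ℂ] ℂ, HasStrictFDerivAt f f' q ∧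
      (f' ∘L .inr ℂ E ℂ).IsInvertible) {θ : E → ℂ} (hθ : ContinuousOn θ B)
    (h0 : ∀ x ∈ B, f (x, θ x) = 0) : DifferentiableOn ℂ θ B := by
  intro x hx
  obtain ⟨f', hf', hinv⟩ := hf (x, θ x) hx (h0 x hx)
  have hev := hf'.eventually_apply_eq_iff_implicitFunctionOfProdDomain hinv
  have ht : Tendsto (fun y => (y, θ y)) (𝓝 x) (𝓝 (x, θ x)) :=
    tendsto_id.prodMk_nhds (hθ.continuousAt (hB.mem_nhds hx))
  refine ((hf'.hasStrictFDerivAt_implicitFunctionOfProdDomain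
    hinv).hasFDerivAt.differentiableAt.congr_of_eventuallyEq ?_).differentiableWithinAt
  filter_upwards [ht.eventually hev, hB.mem_nhds hx] with y hy hyB
  exact (hy.1 ((h0 y hyB).trans (h0 x hx).symm)).symm

/-- A simply connected open set over which the projection of the zero set of `f` is proper,
finite and unramified carries a holomorphic branch of the zero set. -/
theorem exists_differentiableOn_branch [ProperSpace E] {f : E × ℂ → ℂ} (hfc : Continuous f)
    {B : Set E} (hB : IsOpen B) (hBc : IsSimplyConnected B)
    (hf : ∀ q : E × ℂ, q.1 ∈ B → f q = 0 → ∃ f' : E × ℂ →L[ℂ] ℂ, HasStrictFDerivAt f f' q ∧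
      (f' ∘L .inr ℂ E ℂ).IsInvertible)
    (hbdd : ∀ K : Set E, IsCompact K → ∃ M : ℝ, ∀ q : E × ℂ, q.1 ∈ K → f q = 0 → ‖q.2‖ ≤ M)
    (hfin : ∀ x, {t | f (x, t) = 0}.Finite) (hne : ∀ x, ∃ t, f (x, t) = 0) :
    ∃ θ : E → ℂ, DifferentiableOn ℂ θ B ∧ ∀ x ∈ B, f (x, θ x) = 0 := by
  classical
  set π : {q : E × ℂ // f q = 0} → E := fun q => q.1.1
  have hπc : Continuous π := continuous_fst.comp continuous_subtype_val
  have hprop : IsProperMap π := by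
    refine isProperMap_iff_isCompact_preimage.2 ⟨hπc, fun K hK => ?_⟩
    obtain ⟨M, hM⟩ := hbdd K hK
    have hcl : IsClosed {q : E × ℂ | f q = 0} := isClosed_eq hfc continuous_const
    have : π ⁻¹' K = Subtype.val ⁻¹' (K ×ˢ Metric.closedBall (0 : ℂ) M) := by
      ext ⟨q, hq⟩
      simp only [Set.mem_preimage, Set.mem_prod, mem_closedBall_zero_iff, π]
      exact ⟨fun h => ⟨h, hM q h hq⟩, fun h => h.1⟩
    rw [this]
    exact hcl.isClosedEmbedding_subtypeVal.isCompact_preimage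
      (hK.prod (isCompact_closedBall _ _))
  have hcov : IsCoveringMapOn π B := by
    refine hprop.isClosedMap.isCoveringMapOn_of_isLocalHomeomorphOn (fun x _ => ?_)
      (isLocalHomeomorphOn_fst_of_isInvertible hf)
    refine Set.Finite.of_injOn (f := fun q => q.1.2) (t := {t | f (x, t) = 0}) ?_ ?_ (hfin x)
    · rintro ⟨⟨y, t⟩, hq⟩ rfl
      exact hq
    · rintro ⟨⟨y, t⟩, hq⟩ hy ⟨⟨y', t'⟩, hq'⟩ hy' h
      have h1 : y = x := hy
      have h2 : y' = x := hy'
      have h3 : t = t' := h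
      subst h1 h2 h3
      rfl
  have := hBc.simplyConnectedSpace
  have := hB.locallyPathConnectedSpace
  obtain ⟨x₀, hx₀⟩ := hBc.nonempty
  obtain ⟨t₀, ht₀⟩ := hne x₀
  obtain ⟨g, ⟨-, hg⟩, -⟩ := hcov.existsUnique_continuousMap_lifts
    (⟨Subtype.val, continuous_subtype_val⟩ : C(B, E)) (a₀ := ⟨x₀, hx₀⟩) (e₀ := ⟨(x₀, t₀), ht₀⟩)
    rfl (fun x => x.2)
  have hg' : ∀ x : B, (g x).1.1 = x := fun x => congrFun hg x
  obtain ⟨θ, hθ⟩ : ∃ θ : E → ℂ, ∀ x : B, θ x = (g x).1.2 :=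
    ⟨fun x => if hx : x ∈ B then (g ⟨x, hx⟩).1.2 else 0, by simp⟩
  have h0 : ∀ x ∈ B, f (x, θ x) = 0 := fun x hx => by
    have : (x, θ x) = (g ⟨x, hx⟩).1 := Prod.ext (hg' ⟨x, hx⟩).symm (hθ ⟨x, hx⟩)
    rw [this]
    exact (g ⟨x, hx⟩).2
  refine ⟨θ, differentiableOn_of_isInvertible hB hf ?_ h0, h0⟩
  rw [continuousOn_iff_continuous_domRestrict]
  have : B.domRestrict θ = fun x => (g x).1.2 := funext hθ
  rw [this]
  exact continuous_snd.comp (continuous_subtype_val.comp (map_continuous g))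

end Branch

theorem evalPair_eq_eval_map {τ : Type} (x : τ → ℂ) (t : ℂ) (F : Polynomial (MvPolynomial τ ℂ)) :
    evalPair x t F = (F.map (eval x)).eval t :=
  (Polynomial.eval_map _ _).symm

section

variable {τ : Type} [Fintype τ]

theorem contDiff_evalPair (F : Polynomial (MvPolynomial τ ℂ)) :
    ContDiff ℂ 1 fun q : (τ → ℂ) × ℂ => evalPair q.1 q.2 F := by
  have heval : ∀ a : MvPolynomial τ ℂ, ContDiff ℂ 1 fun q : (τ → ℂ) × ℂ => eval q.1 a := by
    intro a
    induction a using MvPolynomial.induction_on with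
    | C a => simpa using contDiff_const
    | add p q hp hq => simpa using hp.add hq
    | mul_X p i hp =>
      simp only [map_mul, eval_X]
      exact hp.mul ((contDiff_apply ℂ ℂ i).comp contDiff_fst)
  induction F using Polynomial.induction_on' with
  | add p q hp hq => simpa using hp.add hq
  | monomial j a =>
    have : ∀ q : (τ → ℂ) × ℂ, evalPair q.1 q.2 (Polynomial.monomial j a) =
        eval q.1 a * q.2 ^ j := fun q => by simp [evalPair]
    simp only [this]
    exact (heval a).mul (contDiff_snd.pow j)

theorem exists_hasStrictFDerivAt_evalPair {F : Polynomial (MvPolynomial τ ℂ)}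
    {q : (τ → ℂ) × ℂ} (hq : evalPair q.1 q.2 F.derivative ≠ 0) :
    ∃ f' : (τ → ℂ) × ℂ →L[ℂ] ℂ,
      HasStrictFDerivAt (fun q : (τ → ℂ) × ℂ => evalPair q.1 q.2 F) f' q ∧
      (f' ∘L .inr ℂ (τ → ℂ) ℂ).IsInvertible := by
  have h := (contDiff_evalPair F).hasStrictFDerivAt (x := q) one_ne_zero
  refine ⟨_, h, ?_⟩
  set L := fderiv ℂ (fun q : (τ → ℂ) × ℂ => evalPair q.1 q.2 F) q ∘L .inr ℂ (τ → ℂ) ℂ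
  have h1 : HasFDerivAt (fun t => evalPair q.1 t F) L q.2 :=
    HasFDerivAt.comp (g := fun q : (τ → ℂ) × ℂ => evalPair q.1 q.2 F) q.2
      (f := fun t => (q.1, t)) h.hasFDerivAt (hasFDerivAt_prodMk_right q.1 q.2)
  have h2 : HasDerivAt (fun t => evalPair q.1 t F) (evalPair q.1 q.2 F.derivative) q.2 := by
    simp only [evalPair_eq_eval_map]
    rw [← Polynomial.derivative_map]
    exact Polynomial.hasDerivAt _ _
  have h3 : L 1 ≠ 0 := by rwa [h1.hasDerivAt.unique h2]
  refine ⟨ContinuousLinearEquiv.unitsEquivAut ℂ (Units.mk0 (L 1) h3), ?_⟩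
  ext
  simp

theorem exists_differentiableOn_evalPair_eq_zero {F S W : Polynomial (MvPolynomial τ ℂ)}
    {D : MvPolynomial τ ℂ} (hF : F.Monic) (hdeg : 0 < F.natDegree)
    (hbez : F * S + F.derivative * W = Polynomial.C D) {c : τ → ℂ} {r : ℝ} (hr : 0 < r)
    (hD : ∀ x ∈ Metric.ball c r, eval x D ≠ 0) :
    ∃ θ : (τ → ℂ) → ℂ, DifferentiableOn ℂ θ (Metric.ball c r) ∧
      ∀ x ∈ Metric.ball c r, evalPair x (θ x) F = 0 := by
  refine exists_differentiableOn_branch (f := fun q => evalPair q.1 q.2 F)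
    (contDiff_evalPair F).continuous Metric.isOpen_ball ?_ (fun q hq h0 => ?_) (fun K hK => ?_)
    (fun x => ?_) (fun x => ?_)
  · exact isSimplyConnected_ball c hr
  · refine exists_hasStrictFDerivAt_evalPair fun h => hD _ hq ?_
    have := congrArg (evalPair q.1 q.2) hbez
    rw [map_add, map_mul, map_mul, h0, h, zero_mul, zero_mul, add_zero, evalPair_C] at this
    exact this.symm
  · obtain ⟨A, hA, m, hm⟩ := exists_norm_root_le hF
    obtain ⟨M, hM⟩ := hK.isBounded.exists_norm_le
    refine ⟨A * (1 + M) ^ m, fun q hq h0 => (hm q.1 q.2 h0).trans ?_⟩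
    gcongr
    exact hM _ hq
  · simp only [evalPair_eq_eval_map]
    exact Polynomial.finite_setOfPred_isRoot (hF.map (eval x)).ne_zero
  · have hd : (F.map (eval x)).degree ≠ 0 := by
      rw [hF.degree_map]
      exact (Polynomial.natDegree_pos_iff_degree_pos.1 hdeg).ne'
    obtain ⟨t, ht⟩ := IsAlgClosed.exists_root _ hd
    exact ⟨t, by rw [evalPair_eq_eval_map]; exact ht⟩

end

theorem exists_differentiableOn_exp_eq {E : Type*} [NormedAddCommGroup E] [NormedSpace ℂ E]
    {c : E} {r : ℝ} (hr : 0 < r) {g : E → ℂ} (hg : DifferentiableOn ℂ g (Metric.ball c r))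
    (hg0 : ∀ x ∈ Metric.ball c r, g x ≠ 0) :
    ∃ l : E → ℂ, DifferentiableOn ℂ l (Metric.ball c r) ∧
      (∀ x ∈ Metric.ball c r, exp (l x) = g x) ∧ |(l c).im| ≤ Real.pi := by
  let _ := NormedSpace.restrictScalars ℝ ℂ E
  obtain ⟨l₀, hl₀, he₀⟩ := exists_continuousOn_eqOn_exp_comp (isSimplyConnected_ball c hr)
    Metric.isOpen_ball hg.continuousOn (by rintro ⟨x, hx, h⟩; exact hg0 x hx h)
  have hc := Metric.mem_ball_self (x := c) hr
  obtain ⟨k, hk⟩ := exp_eq_exp_iff_exists_int.1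
    ((exp_log (hg0 c hc)).trans (he₀ hc).symm : exp (log (g c)) = exp (l₀ c))
  have hexp : ∀ x ∈ Metric.ball c r, exp (l₀ x + k * (2 * Real.pi * I)) = g x := fun x hx => by
    rw [exp_periodic.int_mul k]
    exact he₀ hx
  refine ⟨fun x => l₀ x + k * (2 * Real.pi * I), fun x hx => ?_, hexp, ?_⟩
  · have hball := Metric.isOpen_ball.mem_nhds hx
    have hgx := (hg x hx).differentiableAt hball
    have hl : ContinuousAt l₀ x := hl₀.continuousAt hball
    have hd : DifferentiableAt ℂ (fun y => l₀ x + k * (2 * Real.pi * I) + log (g y * (g x)⁻¹)) x := by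
      refine (DifferentiableAt.clog (hgx.mul_const _) ?_).const_add _
      rw [mul_inv_cancel₀ (hg0 x hx)]
      exact one_mem_slitPlane
    refine (hd.congr_of_eventuallyEq ?_).differentiableWithinAt
    have hnear : ∀ᶠ y in nhds x, |(l₀ y - l₀ x).im| < Real.pi := by
      have h0 : ContinuousAt (fun y => |(l₀ y - l₀ x).im|) x :=
        (continuous_im.continuousAt.comp (hl.sub continuousAt_const)).abs
      exact h0.eventually_lt_const (by simpa using Real.pi_pos)
    filter_upwards [hnear, hball] with y hy hyb
    have : g y * (g x)⁻¹ = exp (l₀ y - l₀ x) := by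
      rw [exp_sub, ← div_eq_mul_inv]
      exact congrArg₂ (· / ·) (he₀ hyb).symm (he₀ hx).symm
    rw [this, log_exp (abs_lt.1 hy).1 (abs_lt.1 hy).2.le]
    ring
  · dsimp only
    rw [← hk, log_im]
    exact abs_arg_le_pi _

section FixedPoint

variable {τ : Type} [Fintype τ]

theorem norm_sub_le_of_abs_re_le {l : (τ → ℂ) → ℂ} {c : τ → ℂ} {r L : ℝ} (hL : 0 < L)
    (hl : DifferentiableOn ℂ l (Metric.ball c r)) (hre : ∀ x ∈ Metric.ball c r, |(l x).re| ≤ L)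
    {x y : τ → ℂ} (hx : x ∈ Metric.closedBall c (r / 4)) (hy : y ∈ Metric.closedBall c (r / 4)) :
    ‖l y - l x‖ ≤ 16 * L / r * ‖y - x‖ := by
  obtain rfl | hxy := eq_or_ne y x
  · simp
  have hpos : 0 < ‖y - x‖ := norm_pos_iff.2 (sub_ne_zero.2 hxy)
  rw [mem_closedBall_iff_norm] at hx hy
  have hle : ‖y - x‖ ≤ r / 2 := by
    have : ‖y - x‖ ≤ ‖y - c‖ + ‖x - c‖ := by
      simpa using norm_sub_le (y - c) (x - c)
    linarith
  have hr : 0 < r := by linarith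
  set R := 3 * r / 4 / ‖y - x‖
  have hR : 3 / 2 ≤ R := by
    rw [le_div_iff₀ hpos]
    linarith
  have hmaps : Set.MapsTo (fun z : ℂ => x + z • (y - x)) (Metric.ball 0 R) (Metric.ball c r) := by
    intro z hz
    rw [mem_ball_zero_iff, lt_div_iff₀ hpos] at hz
    rw [mem_ball_iff_norm]
    calc ‖x + z • (y - x) - c‖ = ‖(x - c) + z • (y - x)‖ := by congr 1; abel
      _ ≤ ‖x - c‖ + ‖z‖ * ‖y - x‖ := (norm_add_le _ _).trans_eq (by rw [norm_smul])
      _ < r := by linarith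
  have hdiff : DifferentiableOn ℂ (fun z : ℂ => l (x + z • (y - x)) - l x) (Metric.ball 0 R) :=
    (hl.comp (by fun_prop) hmaps).sub_const _
  have hxr : x ∈ Metric.ball c r := by
    rw [mem_ball_iff_norm]
    linarith
  have h := borelCaratheodory_zero (M := 2 * L) (R := R) (by positivity) hdiff (fun z hz => ?_)
    (by linarith) (z := 1) (by rw [mem_ball_zero_iff, norm_one]; linarith) (by simp)
  · have h1 : ‖l y - l x‖ ≤ 2 * (2 * L) * 1 / (R - 1) := by simpa using h
    refine h1.trans ?_
    have h2 : 2 * (2 * L) * 1 / (R - 1) ≤ 2 * (2 * L) * 1 / (R / 3) := by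
      gcongr
      linarith
    refine h2.trans_eq ?_
    simp only [R]
    field_simp
    norm_num
  · have h1 := abs_le.1 (hre _ (hmaps hz))
    have h2 := abs_le.1 (hre _ hxr)
    rw [Set.mem_ofPred_eq, sub_re]
    linarith

theorem exists_eq_add_of_abs_re_le {l : τ → (τ → ℂ) → ℂ} {c : τ → ℂ} {r L : ℝ} (hL : 0 < L)
    (hl : ∀ i, DifferentiableOn ℂ (l i) (Metric.ball c r))
    (hre : ∀ i, ∀ x ∈ Metric.ball c r, |(l i x).re| ≤ L) (him : ∀ i, |(l i c).im| ≤ Real.pi)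
    (hr₁ : 32 * L ≤ r) (hr₂ : 8 * (L + Real.pi) ≤ r) :
    ∃ x ∈ Metric.ball c r, ∀ i, x i = c i + l i x := by
  have hr : 0 < r := by linarith
  set f : (τ → ℂ) → (τ → ℂ) := fun x i => c i + l i x
  have hlip : ∀ x ∈ Metric.closedBall c (r / 4), ∀ y ∈ Metric.closedBall c (r / 4),
      ‖f y - f x‖ ≤ 1 / 2 * ‖y - x‖ := by
    intro x hx y hy
    refine (pi_norm_le_iff_of_nonneg (by positivity)).2 fun i => ?_
    have h := norm_sub_le_of_abs_re_le hL (hl i) (hre i) hx hy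
    have hc : 16 * L / r ≤ 1 / 2 := by
      rw [div_le_iff₀ hr]
      linarith
    calc ‖(f y - f x) i‖ = ‖l i y - l i x‖ := by simp [f]
      _ ≤ 16 * L / r * ‖y - x‖ := h
      _ ≤ _ := by gcongr
  have hcc : c ∈ Metric.closedBall c (r / 4) := Metric.mem_closedBall_self (by positivity)
  have hfc : ‖f c - c‖ ≤ r / 8 := by
    refine (pi_norm_le_iff_of_nonneg (by positivity)).2 fun i => ?_
    have h1 := norm_le_abs_re_add_abs_im (l i c)
    have h2 := hre i c (Metric.mem_ball_self hr)
    have h3 := him i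
    calc ‖(f c - c) i‖ = ‖l i c‖ := by simp [f]
      _ ≤ r / 8 := by linarith
  have hmaps : Set.MapsTo f (Metric.closedBall c (r / 4)) (Metric.closedBall c (r / 4)) := by
    intro x hx
    have h := hlip c hcc x hx
    rw [mem_closedBall_iff_norm] at hx ⊢
    calc ‖f x - c‖ = ‖(f x - f c) + (f c - c)‖ := by rw [sub_add_sub_cancel]
      _ ≤ ‖f x - f c‖ + ‖f c - c‖ := norm_add_le _ _
      _ ≤ r / 4 := by linarith
  obtain ⟨x, hx, hfix, -⟩ := ContractingWith.exists_fixedPoint' (K := 1 / 2) (f := f)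
    Metric.isClosed_closedBall.isComplete hmaps
    ⟨by rw [← NNReal.coe_lt_coe]; norm_num, LipschitzWith.of_dist_le_mul fun x y => by
      have := hlip y y.2 x x.2
      rw [← dist_eq_norm, ← dist_eq_norm] at this
      simpa [Subtype.dist_eq] using this⟩ hcc (edist_ne_top _ _)
  refine ⟨x, Metric.closedBall_subset_ball (by linarith) hx, fun i => ?_⟩
  exact (congrFun hfix i).symm

end FixedPoint

open Asymptotics Filter in
theorem eventually_log_mul_pow_add_le {K b ε : ℝ} (hK : 0 < K) (hb : 0 < b) (hε : 0 < ε) (m : ℕ)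
    (C : ℝ) : ∀ᶠ N : ℕ in atTop, Real.log (K * (1 + b * N) ^ m) + C ≤ ε * N := by
  have hid : (fun N : ℕ => 1 + b * (N : ℝ)) =O[atTop] fun N : ℕ => (N : ℝ) := by
    refine IsBigO.add (isLittleO_const_id_atTop (1 : ℝ) |>.isBigO.comp_tendsto
      tendsto_natCast_atTop_atTop) ((isBigO_refl _ _).const_mul_left b)
  have htend : Tendsto (fun N : ℕ => 1 + b * (N : ℝ)) atTop atTop :=
    tendsto_atTop_add_const_left _ _ (tendsto_natCast_atTop_atTop.const_mul_atTop hb)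
  have hlog : (fun N : ℕ => Real.log (1 + b * N)) =o[atTop] fun N : ℕ => (N : ℝ) :=
    (Real.isLittleO_log_id_atTop.comp_tendsto htend).trans_isBigO hid
  have hconst : (fun _ : ℕ => Real.log K + C) =o[atTop] fun N : ℕ => (N : ℝ) :=
    (isLittleO_const_id_atTop _).comp_tendsto tendsto_natCast_atTop_atTop
  filter_upwards [(hconst.add (hlog.const_mul_left m)).def hε] with N hN
  have h1 : (0 : ℝ) < 1 + b * N := by positivity
  rw [Real.log_mul hK.ne' (pow_pos h1 m).ne', Real.log_pow]
  rw [Real.norm_natCast] at hN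
  linarith [Real.le_norm_self (Real.log K + C + m * Real.log (1 + b * N))]

theorem differentiableOn_evalPair_div {τ : Type} [Fintype τ] {D : MvPolynomial τ ℂ}
    (G : Polynomial (MvPolynomial τ ℂ)) {θ : (τ → ℂ) → ℂ} {B : Set (τ → ℂ)}
    (hθ : DifferentiableOn ℂ θ B) (hD : ∀ x ∈ B, eval x D ≠ 0) :
    DifferentiableOn ℂ (fun x => evalPair x (θ x) G / eval x D) B := by
  have hdiff : ∀ F : Polynomial (MvPolynomial τ ℂ),
      DifferentiableOn ℂ (fun x => evalPair x (θ x) F) B := fun F =>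
    Differentiable.comp_differentiableOn (g := fun q : (τ → ℂ) × ℂ => evalPair q.1 q.2 F)
      (f := fun x => (x, θ x)) ((contDiff_evalPair F).differentiable one_ne_zero)
      (differentiableOn_id.prodMk hθ)
  have hDd : DifferentiableOn ℂ (fun x => (eval x D)⁻¹) B := by
    refine DifferentiableOn.inv ?_ hD
    simpa only [evalPair_C] using hdiff (Polynomial.C D)
  simp only [div_eq_mul_inv]
  exact (hdiff G).mul hDd

/-- A system `exp (a i) = Gᵢ(a, θ) / D(a)`, with `θ` algebraic over the coordinates of `a` and the
right-hand sides invertible, has a solution. -/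
theorem exists_exp_eq_evalPair_div {τ : Type} [Fintype τ] {F S W : Polynomial (MvPolynomial τ ℂ)}
    {D : MvPolynomial τ ℂ} {G H : τ → Polynomial (MvPolynomial τ ℂ)} (hF : F.Monic)
    (hdeg : 0 < F.natDegree) (hD : D ≠ 0) (hbez : F * S + F.derivative * W = Polynomial.C D)
    (hGH : ∀ i, F ∣ G i * H i - Polynomial.C (D ^ 2)) :
    ∃ (a : τ → ℂ) (t : ℂ), eval a D ≠ 0 ∧ evalPair a t F = 0 ∧
      ∀ i, exp (a i) = evalPair a t (G i) / eval a D := by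
  obtain ⟨k, ε, c, N₀, hε, hc, hDc⟩ := exists_forall_le_norm_eval hD
  choose A hA m hm using fun i => exists_norm_evalPair_le hF (G i)
  choose A' hA' m' hm' using fun i => exists_norm_evalPair_le hF (H i)
  set u : τ → ℂ := fun i => 2 * Real.pi * I * (k i : ℂ)
  set b : ℝ := ‖u‖ + ε
  have hb : 0 < b := by positivity
  set M : ℕ := ∑ i, (m i + m' i)
  set K : ℝ := 1 + (∑ i, (A i + A' i)) / c
  have hsum : 0 ≤ ∑ i, (A i + A' i) := Finset.sum_nonneg fun i _ => add_nonneg (hA i) (hA' i)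
  have hK1 : 1 ≤ K := le_add_of_nonneg_right (by positivity)
  obtain ⟨N, hN, hNN₀, hNpos⟩ := ((eventually_log_mul_pow_add_le (by linarith : 0 < K) hb
    (by positivity : 0 < ε / 32) M (1 + Real.pi)).and ((Filter.eventually_ge_atTop N₀).and
    (Filter.eventually_gt_atTop 0))).exists
  have hNpos' : (0 : ℝ) < N := by exact_mod_cast hNpos
  set L := Real.log (K * (1 + b * N) ^ M) + 1
  have h1b : 1 ≤ 1 + b * N := le_add_of_nonneg_right (by positivity)
  have hbase : 1 ≤ K * (1 + b * N) ^ M := one_le_mul_of_one_le_of_one_le hK1 (one_le_pow₀ h1b)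
  have hL : 0 < L := add_pos_of_nonneg_of_pos (Real.log_nonneg hbase) one_pos
  set r := ε * N
  have hr : 0 < r := by positivity
  set p : τ → ℂ := (N : ℂ) • u
  have hD0 : ∀ x ∈ Metric.ball p r, eval x D ≠ 0 := fun x hx h => by
    have := hDc N hNN₀ x hx
    rw [h, norm_zero] at this
    linarith
  obtain ⟨θ, hθ, hθ0⟩ := exists_differentiableOn_evalPair_eq_zero hF hdeg hbez hr hD0
  have hnorm : ∀ x ∈ Metric.ball p r, 1 + ‖x‖ ≤ 1 + b * N := fun x hx => by
    rw [mem_ball_iff_norm] at hx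
    have h1 : ‖x‖ ≤ ‖x - p‖ + ‖p‖ := by simpa using norm_add_le (x - p) p
    have h2 : ‖p‖ = N * ‖u‖ := by simp only [p, norm_smul, Complex.norm_natCast]
    simp only [b, r] at hx ⊢
    nlinarith
  have hbound : ∀ (B : ℝ) (j : ℕ), 0 ≤ B → B ≤ ∑ i, (A i + A' i) → j ≤ M → ∀ x ∈ Metric.ball p r,
      ∀ z : ℂ, ‖z‖ ≤ B * (1 + ‖x‖) ^ j → ‖z / eval x D‖ ≤ K * (1 + b * N) ^ M := by
    intro B j hB hBA hj x hx z hz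
    have hDx := hDc N hNN₀ x hx
    rw [norm_div]
    calc ‖z‖ / ‖eval x D‖ ≤ (∑ i, (A i + A' i)) * (1 + b * N) ^ M / c := by
          gcongr
          refine hz.trans ?_
          gcongr
          exact (pow_le_pow_left₀ (by positivity) (hnorm x hx) j).trans (pow_le_pow_right₀ h1b hj)
      _ = (∑ i, (A i + A' i)) / c * (1 + b * N) ^ M := by ring
      _ ≤ K * (1 + b * N) ^ M := by
          gcongr
          simp only [K]
          linarith
  have hle : ∀ i, A i + A' i ≤ ∑ i, (A i + A' i) := fun i => Finset.single_le_sum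
    (f := fun i => A i + A' i) (fun i _ => add_nonneg (hA i) (hA' i)) (Finset.mem_univ i)
  have hle' : ∀ i, m i + m' i ≤ M := fun i => Finset.single_le_sum
    (f := fun i => m i + m' i) (fun i _ => Nat.zero_le _) (Finset.mem_univ i)
  set y : τ → (τ → ℂ) → ℂ := fun i x => evalPair x (θ x) (G i) / eval x D
  have hmul : ∀ i, ∀ x ∈ Metric.ball p r, y i x * (evalPair x (θ x) (H i) / eval x D) = 1 := by
    intro i x hx
    obtain ⟨Q, hQ⟩ := hGH i
    have h := congrArg (evalPair x (θ x)) hQ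
    rw [map_mul, hθ0 x hx, zero_mul, map_sub, map_mul, evalPair_C, map_pow, sub_eq_zero] at h
    rw [div_mul_div_comm, h, sq, div_self (mul_self_ne_zero.2 (hD0 x hx))]
  have hy0 : ∀ i, ∀ x ∈ Metric.ball p r, y i x ≠ 0 := fun i x hx =>
    left_ne_zero_of_mul_eq_one (hmul i x hx)
  have hyd : ∀ i, DifferentiableOn ℂ (y i) (Metric.ball p r) := fun i =>
    differentiableOn_evalPair_div (G i) hθ hD0
  choose l hl hlexp hlim using fun i => exists_differentiableOn_exp_eq hr (hyd i) (hy0 i)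
  have hre : ∀ i, ∀ x ∈ Metric.ball p r, |(l i x).re| ≤ L := by
    intro i x hx
    have h1 : (l i x).re = Real.log ‖y i x‖ := by rw [← hlexp i x hx, norm_exp, Real.log_exp]
    have hpos : 0 < ‖y i x‖ := norm_pos_iff.2 (hy0 i x hx)
    have h2 : ‖y i x‖ ≤ K * (1 + b * N) ^ M :=
      hbound (A i) (m i) (hA i) (by linarith [hle i, hA' i]) (by linarith [hle' i]) x hx _
        (hm i x _ (hθ0 x hx))
    have h3 : ‖y i x‖⁻¹ ≤ K * (1 + b * N) ^ M := by
      rw [← norm_inv, inv_eq_of_mul_eq_one_right (hmul i x hx)]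
      exact hbound (A' i) (m' i) (hA' i) (by linarith [hle i, hA i]) (by linarith [hle' i]) x hx _
        (hm' i x _ (hθ0 x hx))
    rw [h1, abs_le]
    have h4 := Real.log_le_log (inv_pos.2 hpos) h3
    have h5 := Real.log_le_log hpos h2
    rw [Real.log_inv] at h4
    constructor <;> simp only [L] <;> linarith
  have hπ := Real.pi_pos
  have hNr : 32 * (L + Real.pi) ≤ r := by
    simp only [L, r]
    linarith
  obtain ⟨x, hx, hfix⟩ := exists_eq_add_of_abs_re_le hL hl hre hlim (by linarith) (by linarith)
  refine ⟨x, θ x, hD0 x hx, hθ0 x hx, fun i => ?_⟩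
  have hexp : exp (p i) = 1 := by
    refine exp_eq_one_iff.2 ⟨N * k i, ?_⟩
    simp only [p, u, Pi.smul_apply, smul_eq_mul]
    push_cast
    ring
  rw [hfix i, exp_add, hexp, one_mul, hlexp i x hx]

section Counting

variable {K A : Type*} [Field K] [CommRing A] [Algebra K A]

theorem Submodule.span_insert_one_pow_le {ι : Type*} [Fintype ι] (l : ι → A) (k : ℕ) :
    Submodule.span K (insert 1 (Set.range l)) ^ k ≤
      Submodule.span K (Set.range fun f : ι → Fin (k + 1) => ∏ j, l j ^ (f j : ℕ)) := by
  classical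
  induction k with
  | zero =>
    rw [pow_zero, Submodule.one_eq_span, Submodule.span_le]
    rintro _ rfl
    exact Submodule.subset_span ⟨fun _ => 0, by simp⟩
  | succ k ih =>
    rw [pow_succ]
    refine (mul_le_mul' ih le_rfl).trans ?_
    rw [Submodule.span_mul_span, Submodule.span_le]
    rintro _ ⟨_, ⟨f, rfl⟩, _, rfl | ⟨j, rfl⟩, rfl⟩
    · exact Submodule.subset_span ⟨fun i => (f i).castSucc, by simp⟩
    · refine Submodule.subset_span ⟨Function.update (fun i => (f i).castSucc) j (f j).succ, ?_⟩
      dsimp only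
      rw [← Finset.mul_prod_erase _ _ (Finset.mem_univ j), Function.update_self, Fin.val_succ,
        pow_succ, ← Finset.mul_prod_erase _ (fun i => l i ^ (f i : ℕ)) (Finset.mem_univ j)]
      rw [Finset.prod_congr rfl fun i hi => by
        rw [Function.update_of_ne (Finset.ne_of_mem_erase hi), Fin.val_castSucc]]
      ring

theorem Submodule.mul_pow_mem {U B : Submodule K A} {x : A} (h1 : 1 ∈ B)
    (h : ∀ y ∈ B, x * y ∈ U * B) (s : ℕ) : x ^ s ∈ U ^ s * B := by
  induction s with
  | zero => simpa using h1
  | succ s ih =>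
    rw [pow_succ' x, pow_succ]
    refine Submodule.mul_induction_on ih (fun u hu y hy => ?_) fun y z hy hz => ?_
    · rw [mul_left_comm, mul_assoc]
      exact Submodule.mul_mem_mul hu (h y hy)
    · rw [mul_add]
      exact add_mem hy hz

/-- If `y` is a root of a polynomial with coefficients in `U`, multiplication by the leading
coefficient times `y` maps the span of the low powers of `y` to its multiple by `U`. -/
theorem Submodule.leadingCoeff_mul_mem {U : Submodule K A} {y : A} {P : Polynomial A}
    (hP : P.eval y = 0) (hU : ∀ j, P.coeff j ∈ U) {z : A}
    (hz : z ∈ Submodule.span K (Set.range fun j : Fin P.natDegree => y ^ (j : ℕ))) :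
    P.leadingCoeff * y * z ∈
      U * Submodule.span K (Set.range fun j : Fin P.natDegree => y ^ (j : ℕ)) := by
  have hmem : ∀ j < P.natDegree,
      y ^ j ∈ Submodule.span K (Set.range fun j : Fin P.natDegree => y ^ (j : ℕ)) :=
    fun j hj => Submodule.subset_span ⟨⟨j, hj⟩, rfl⟩
  induction hz using Submodule.span_induction with
  | mem z hz =>
    obtain ⟨j, rfl⟩ := hz
    dsimp only
    rw [mul_assoc, ← pow_succ']
    rcases (Nat.succ_le_of_lt j.2).lt_or_eq with hj | hj
    · exact Submodule.mul_mem_mul (hU _) (hmem _ hj)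
    · have : P.leadingCoeff * y ^ (j + 1 : ℕ) =
          -∑ i ∈ Finset.range P.natDegree, P.coeff i * y ^ i := by
        rw [Polynomial.eval_eq_sum_range, Finset.sum_range_succ] at hP
        rw [show (j + 1 : ℕ) = P.natDegree from hj, Polynomial.leadingCoeff]
        linear_combination hP
      rw [this]
      exact neg_mem (sum_mem fun i hi => Submodule.mul_mem_mul (hU _) (hmem i (Finset.mem_range.1 hi)))
  | zero => simp
  | add z w _ _ hz hw =>
    rw [mul_add]
    exact add_mem hz hw
  | smul c z _ hz =>
    rw [mul_smul_comm]
    exact Submodule.smul_mem _ _ hz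

theorem Submodule.prod_mem_prod {ι : Type*} (s : Finset ι) {U : ι → Submodule K A} {x : ι → A}
    (h : ∀ i ∈ s, x i ∈ U i) : ∏ i ∈ s, x i ∈ ∏ i ∈ s, U i := by
  classical
  induction s using Finset.induction_on with
  | empty =>
    rw [Finset.prod_empty, Finset.prod_empty]
    exact Submodule.one_le.1 le_rfl
  | insert i s hi ih =>
    rw [Finset.prod_insert hi, Finset.prod_insert hi]
    exact Submodule.mul_mem_mul (h i (Finset.mem_insert_self i s))
      (ih fun j hj => h j (Finset.mem_insert_of_mem hj))

theorem MvPolynomial.aeval_mem_pow {σ : Type*} {U : Submodule K A} (h1 : 1 ∈ U) {a : σ → A}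
    (ha : ∀ i, a i ∈ U) {p : MvPolynomial σ K} {δ : ℕ} (hp : p.totalDegree ≤ δ) :
    aeval a p ∈ U ^ δ := by
  rw [aeval_def, eval₂_eq]
  refine sum_mem fun m hm => ?_
  rw [← Algebra.smul_def]
  refine Submodule.smul_mem _ _ ?_
  have hle : (∑ i ∈ m.support, m i) ≤ δ := (le_totalDegree hm).trans hp
  have hmem : ∏ i ∈ m.support, a i ^ m i ∈ U ^ ∑ i ∈ m.support, m i := by
    rw [← Finset.prod_pow_eq_pow_sum]
    exact Submodule.prod_mem_prod _ fun i _ => Submodule.pow_mem_pow _ (ha i) _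
  exact pow_le_pow_right' (Submodule.one_le.2 h1) hle hmem

end Counting

/-- If the `b i` satisfy polynomial equations over `K(a)` and the `a i` lie in the span of `1` and
of `d` elements, then the number of linearly independent monomials in `b` of partial degrees at
most `N` grows at most like `N ^ d`. -/
theorem card_le_of_linearIndependent_monomials {K A : Type*} [Field K] [CommRing A] [IsDomain A]
    [Algebra K A] {n d N δ : ℕ} {l : Fin d → A} {a b : Fin n → A}
    (ha : ∀ i, a i ∈ Submodule.span K (insert 1 (Set.range l)))
    {P : Fin n → Polynomial (MvPolynomial (Fin n) K)}
    (hP : ∀ i, (P i).eval₂ (aeval a : MvPolynomial (Fin n) K →ₐ[K] A).toRingHom (b i) = 0)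
    (hlead : ∀ i, aeval a (P i).leadingCoeff ≠ 0)
    (hδ : ∀ i j, ((P i).coeff j).totalDegree ≤ δ)
    (hli : LinearIndependent K fun e : Fin n → Fin (N + 1) => ∏ i, b i ^ (e i : ℕ)) :
    (N + 1) ^ n ≤ (n * N * δ + 1) ^ d * ∏ i, (P i).natDegree := by
  classical
  set φ := (aeval a : MvPolynomial (Fin n) K →ₐ[K] A).toRingHom
  set p : Fin n → A := fun i => aeval a (P i).leadingCoeff
  have hdeg : ∀ i, ((P i).map φ).natDegree = (P i).natDegree := fun i =>
    Polynomial.natDegree_map_of_leadingCoeff_ne_zero φ (hlead i)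
  have hlc : ∀ i, ((P i).map φ).leadingCoeff = p i := fun i =>
    Polynomial.leadingCoeff_map_of_leadingCoeff_ne_zero φ (hlead i)
  have hroot : ∀ i, ((P i).map φ).eval (b i) = 0 := fun i => by rw [Polynomial.eval_map, hP]
  have hpos : ∀ i, 0 < ((P i).map φ).natDegree := fun i => by
    by_contra! h
    have h0 := hroot i
    rw [Polynomial.eq_C_of_natDegree_le_zero h, Polynomial.eval_C, ← Nat.le_zero.1 h,
      Polynomial.coeff_natDegree, hlc] at h0
    exact hlead i h0
  set U := Submodule.span K (insert 1 (Set.range l))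
  have h1U : (1 : A) ∈ U := Submodule.subset_span (Set.mem_insert _ _)
  have hcoeff : ∀ i j, ((P i).map φ).coeff j ∈ U ^ δ := fun i j => by
    rw [Polynomial.coeff_map]
    exact aeval_mem_pow h1U ha (hδ i j)
  set B : Fin n → Submodule K A := fun i =>
    Submodule.span K (Set.range fun j : Fin ((P i).map φ).natDegree => b i ^ (j : ℕ))
  have hB1 : ∀ i, (1 : A) ∈ B i := fun i => Submodule.subset_span ⟨⟨0, hpos i⟩, pow_zero _⟩
  have hfactor : ∀ i (s : ℕ), s ≤ N → p i ^ N * b i ^ s ∈ (U ^ δ) ^ N * B i := by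
    intro i s hs
    obtain ⟨t, rfl⟩ := Nat.exists_eq_add_of_le' hs
    have h1 : (p i * b i) ^ s ∈ (U ^ δ) ^ s * B i :=
      Submodule.mul_pow_mem (hB1 i) (fun z hz => hlc i ▸
        Submodule.leadingCoeff_mul_mem (hroot i) (hcoeff i) hz) s
    have h2 : p i ^ t ∈ (U ^ δ) ^ t := Submodule.pow_mem_pow _ (hlc i ▸ hcoeff i _) t
    have h3 := Submodule.mul_mem_mul h2 h1
    rw [← mul_assoc, ← pow_add] at h3
    convert h3 using 1
    ring
  have hmem : ∀ e : Fin n → Fin (N + 1),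
      (∏ i, p i ^ N) * ∏ i, b i ^ (e i : ℕ) ∈ U ^ (n * N * δ) * ∏ i, B i := by
    intro e
    have h := Submodule.prod_mem_prod Finset.univ fun i _ =>
      hfactor i (e i) (Nat.lt_succ_iff.1 (e i).2)
    rw [Finset.prod_mul_distrib, Finset.prod_mul_distrib, Finset.prod_const, Finset.card_univ,
      Fintype.card_fin, ← pow_mul, ← pow_mul] at h
    convert h using 3
    ring
  have hle : U ^ (n * N * δ) * ∏ i, B i ≤ Submodule.span K (Set.range
      fun q : (Fin d → Fin (n * N * δ + 1)) × (∀ i, Fin ((P i).map φ).natDegree) =>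
        (∏ j, l j ^ (q.1 j : ℕ)) * ∏ i, b i ^ (q.2 i : ℕ)) := by
    refine (mul_le_mul' (Submodule.span_insert_one_pow_le l _) le_rfl).trans ?_
    simp only [B]
    rw [Submodule.prod_span, Submodule.span_mul_span, Submodule.span_le]
    rintro _ ⟨_, ⟨f, rfl⟩, z, hz, rfl⟩
    obtain ⟨g, hg, rfl⟩ := (Set.mem_fintype_prod _ _).1 hz
    choose j hj using hg
    refine Submodule.subset_span ⟨(f, j), ?_⟩
    simp only [← hj]
  have hp0 : ∏ i, p i ^ N ≠ 0 := Finset.prod_ne_zero_iff.2 fun i _ => pow_ne_zero _ (hlead i)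
  have hli' : LinearIndependent K fun e : Fin n → Fin (N + 1) =>
      (∏ i, p i ^ N) * ∏ i, b i ^ (e i : ℕ) :=
    hli.map' (LinearMap.mulLeft K (∏ i, p i ^ N))
      (LinearMap.ker_eq_bot.2 (mul_right_injective₀ hp0))
  have hcard := linearIndependent_le_span_aux' _ hli' _
    (Set.range_subset_iff.2 fun e => hle (hmem e))
  refine le_trans ?_ (hcard.trans ((Fintype.card_range_le _).trans_eq ?_))
  · simp
  · simp [hdeg]

/-- Distinct Laurent monomials in algebraically independent elements are linearly independent. -/
theorem AlgebraicIndependent.linearIndependent_prod_zpow {K A ι κ : Type*} [Field K] [Field A]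
    [Algebra K A] [Fintype ι] [Finite κ] {c : ι → A} (hc : AlgebraicIndependent K c)
    {k : κ → ι → ℤ} (hk : Function.Injective k) :
    LinearIndependent K fun e => ∏ j, c j ^ k e j := by
  classical
  cases nonempty_fintype κ
  have hc0 : ∀ j, c j ≠ 0 := fun j => hc.ne_zero j
  obtain ⟨s, hs⟩ : ∃ s : ℕ, ∀ e j, 0 ≤ k e j + s := by
    refine ⟨∑ e, ∑ j, (k e j).natAbs, fun e j => ?_⟩
    have h1 := Finset.single_le_sum (f := fun j => (k e j).natAbs) (fun _ _ => Nat.zero_le _)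
      (Finset.mem_univ j)
    have h2 := Finset.single_le_sum (f := fun e => ∑ j, (k e j).natAbs) (fun _ _ => Nat.zero_le _)
      (Finset.mem_univ e)
    omega
  set m : κ → ι →₀ ℕ := fun e => Finsupp.equivFunOnFinite.symm fun j => (k e j + s).toNat
  have hm : Function.Injective m := fun e e' h => hk <| funext fun j => by
    have h1 : (k e j + s).toNat = (k e' j + s).toNat :=
      congrFun (Finsupp.equivFunOnFinite.symm.injective h) j
    have h2 := hs e j
    have h3 := hs e' j
    omega
  have hli : LinearIndependent K fun e => aeval c (monomial (m e) (1 : K)) :=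
    ((basisMonomials ι K).linearIndependent.comp m hm).map' (aeval c).toLinearMap
      (LinearMap.ker_eq_bot.2 hc)
  have hmon : ∀ e, aeval c (monomial (m e) (1 : K)) = (∏ j, c j ^ s) * ∏ j, c j ^ k e j := by
    intro e
    rw [aeval_monomial, map_one, one_mul, Finsupp.prod_fintype _ _ fun _ => pow_zero _,
      ← Finset.prod_mul_distrib]
    refine Finset.prod_congr rfl fun j _ => ?_
    have : m e j = (k e j + s).toNat := rfl
    rw [this, ← zpow_natCast, ← zpow_natCast, Int.toNat_of_nonneg (hs e j), zpow_add₀ (hc0 j),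
      mul_comm]
  simp only [hmon] at hli
  exact .of_comp (LinearMap.mulLeft K (∏ j, c j ^ s)) hli

open AlgebraicIndependent in
/-- A family of `d` elements over which `d` algebraically independent elements are algebraic is
algebraically independent, and the two generate the same algebraic closure. -/
theorem AlgebraicIndependent.of_isAlgebraic_adjoin {K A : Type*} [Field K] [Field A] [Algebra K A]
    {d : ℕ} {c : Fin d → A} {t : Finset A} (ht : t.card = d)
    (hti : AlgebraicIndependent K (Subtype.val : ↥(t : Set A) → A))
    (halg : ∀ x ∈ t, IsAlgebraic (Algebra.adjoin K (Set.range c)) x) :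
    AlgebraicIndependent K c ∧ ∀ x : A, IsAlgebraic (Algebra.adjoin K (Set.range c)) x →
      IsAlgebraic (Algebra.adjoin K (t : Set A)) x := by
  set M := matroid K A
  have htM : M.Indep (t : Set A) := hti
  have hcl : ∀ {s : Set A} {x : A}, x ∈ M.closure s ↔ IsAlgebraic (Algebra.adjoin K s) x := by
    intro s x
    rw [matroid_closure_eq, SetLike.mem_coe, Subalgebra.mem_algebraicClosure]
  have htc : (t : Set A) ⊆ M.closure (Set.range c) := fun x hx => hcl.2 (halg x hx)
  have hcard : (Set.range c).encard ≤ d := by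
    rw [← Set.image_univ]
    exact (Set.encard_image_le _ _).trans (by simp)
  have hrk : (d : ℕ∞) ≤ M.eRk (Set.range c) := by
    have h := htM.encard_le_eRk_of_subset htc
    rwa [M.eRk_closure_eq, Set.encard_coe_eq_coe_finsetCard, ht] at h
  have hind : M.Indep (Set.range c) :=
    (Matroid.indep_iff_eRk_eq_encard_of_finite (Set.finite_range c)).2
      (le_antisymm (M.eRk_le_encard _) (hcard.trans hrk))
  have hinj : Function.Injective c := by
    have h : d ≤ (Set.range c).ncard := by
      have := hrk.trans (M.eRk_le_encard _)
      rw [← (Set.finite_range c).cast_ncard_eq] at this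
      exact_mod_cast this
    rw [← Set.image_univ] at h
    refine Set.injOn_univ.1 (Set.injOn_of_ncard_image_eq (le_antisymm ?_ ?_))
    · exact Set.ncard_image_le Set.finite_univ
    · simpa [Set.ncard_univ] using h
  refine ⟨.of_subtype_range hinj hind, fun x hx => ?_⟩
  have hb : M.IsBasis (t : Set A) (M.closure (Set.range c)) := by
    refine htM.isBasis_of_eRk_ge t.finite_toSet htc ?_
    rw [M.eRk_closure_eq, htM.eRk_eq_encard, Set.encard_coe_eq_coe_finsetCard, ht]
    exact (M.eRk_le_encard _).trans hcard
  exact hcl.1 (hb.subset_closure (hcl.2 hx))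

theorem isAlgebraic_adjoin_of_eval₂_eq_zero {K A : Type*} [Field K] [Field A] [Algebra K A]
    {ι : Type*} {b : ι → A} {z : A} {Q : Polynomial (MvPolynomial ι K)}
    (hQ : Q.eval₂ (aeval b : MvPolynomial ι K →ₐ[K] A).toRingHom z = 0)
    (hlead : aeval b Q.leadingCoeff ≠ 0) :
    IsAlgebraic (Algebra.adjoin K (Set.range b)) z := by
  set φ : MvPolynomial ι K →ₐ[K] Algebra.adjoin K (Set.range b) :=
    aeval fun i => ⟨b i, Algebra.subset_adjoin ⟨i, rfl⟩⟩
  have hφ : ((Algebra.adjoin K (Set.range b)).val.comp φ) = aeval b :=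
    algHom_ext fun i => by simp [φ]
  refine ⟨Q.map φ.toRingHom, fun h => hlead ?_, ?_⟩
  · have h0 : φ Q.leadingCoeff = 0 := by
      simpa using congrArg (fun p => p.coeff Q.natDegree) h
    rw [← hφ, AlgHom.comp_apply, h0, map_zero]
  · rw [Polynomial.aeval_def, Polynomial.eval₂_map, ← hQ, ← hφ]
    rfl

/-- A point with no small integral linear relation, whose exponentials are algebraic over it and
conversely, with bounded degrees, is linearly independent over `ℚ` by Schanuel's conjecture. -/
theorem SchanuelConjecture.linearIndependent (hSC : SchanuelConjecture) {n δ : ℕ} {a : Fin n → ℂ}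
    {P : Fin n → Polynomial (MvPolynomial (Fin n) ℚ)}
    (hP : ∀ i, (P i).eval₂ (aeval a : MvPolynomial (Fin n) ℚ →ₐ[ℚ] ℂ).toRingHom (exp (a i)) = 0)
    (hlead : ∀ i, aeval a (P i).leadingCoeff ≠ 0)
    (hδ : ∀ i j, ((P i).coeff j).totalDegree ≤ δ)
    (halg : ∀ i, IsAlgebraic (Algebra.adjoin ℚ (Set.range fun i => exp (a i))) (a i))
    (hN : ∀ m : Fin n → ℤ, m ≠ 0 →
      (∀ i, |m i| ≤ ((n * δ + 1) ^ (n - 1) * ∏ i, (P i).natDegree : ℕ)) → ∑ i, m i * a i ≠ 0) :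
    LinearIndependent ℚ a := by
  classical
  by_contra hdep
  set N := (n * δ + 1) ^ (n - 1) * ∏ i, (P i).natDegree with hNdef
  set L := Submodule.span ℤ (Set.range a)
  have : Module.Finite ℤ L := .span_of_finite ℤ (Set.finite_range a)
  set d := Module.finrank ℤ L
  set β := Module.finBasis ℤ L
  set l : Fin d → ℂ := fun j => β j
  have hl : LinearIndependent ℚ l :=
    (LinearIndependent.iff_fractionRing ℤ ℚ).1
      (β.linearIndependent.map' L.subtype (Submodule.ker_subtype L))
  set M : Fin n → Fin d → ℤ := fun i => β.repr ⟨a i, Submodule.subset_span ⟨i, rfl⟩⟩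
  have hM : ∀ i, ∑ j, (M i j : ℂ) * l j = a i := fun i => by
    have h := congrArg Subtype.val (β.sum_repr ⟨a i, Submodule.subset_span ⟨i, rfl⟩⟩)
    simpa only [Submodule.coe_sum, Submodule.coe_smul, zsmul_eq_mul] using h
  have hla : ∀ j, l j ∈ Submodule.span ℤ (Set.range a) := fun j => (β j).2
  have hdn : d < n := by
    have h1 : Module.finrank ℚ (Submodule.span ℚ (Set.range a)) < n := by
      rw [linearIndependent_iff_card_le_finrank_span, not_le, Fintype.card_fin] at hdep
      exact hdep
    have h2 : Submodule.span ℚ (Set.range l) ≤ Submodule.span ℚ (Set.range a) :=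
      Submodule.span_le.2 <| Set.range_subset_iff.2 fun j =>
        Submodule.span_subset_span ℤ ℚ _ (hla j)
    have : FiniteDimensional ℚ (Submodule.span ℚ (Set.range a)) :=
      .span_of_finite ℚ (Set.finite_range a)
    have h3 := Submodule.finrank_mono h2
    rw [finrank_span_eq_card hl, Fintype.card_fin] at h3
    omega
  set c : Fin d → ℂ := fun j => exp (l j)
  have hb : ∀ i, exp (a i) = ∏ j, c j ^ M i j := fun i => by
    rw [← hM, exp_sum]
    exact Finset.prod_congr rfl fun j _ => exp_int_mul _ _
  have hbc : ∀ i, IsAlgebraic (Algebra.adjoin ℚ (Set.range c)) (exp (a i)) := by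
    intro i
    rw [hb, ← Subalgebra.mem_algebraicClosure]
    refine prod_mem fun j _ => ?_
    have hj : IsAlgebraic (Algebra.adjoin ℚ (Set.range c)) (c j) :=
      isAlgebraic_algebraMap (⟨c j, Algebra.subset_adjoin ⟨j, rfl⟩⟩ : Algebra.adjoin ℚ (Set.range c))
    rw [Subalgebra.mem_algebraicClosure]
    cases M i j with
    | ofNat k => simpa using hj.pow k
    | negSucc k => simpa only [zpow_negSucc] using (hj.pow (k + 1)).inv
  have hac : ∀ i, IsAlgebraic (Algebra.adjoin ℚ (Set.range c)) (a i) := fun i =>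
    (halg i).adjoin_of_forall_isAlgebraic <| by
      rintro _ ⟨⟨i, rfl⟩, -⟩
      exact hbc i
  have hlc : ∀ j, IsAlgebraic (Algebra.adjoin ℚ (Set.range c)) (l j) := by
    intro j
    obtain ⟨m, hm⟩ := (Submodule.mem_span_range_iff_exists_fun ℤ).1 (hla j)
    rw [← hm, ← Subalgebra.mem_algebraicClosure]
    exact sum_mem fun i _ => zsmul_mem ((Subalgebra.mem_algebraicClosure _ _).2 (hac i)) _
  obtain ⟨t, hts, htcard, hti⟩ := hSC d l
  rw [finrank_span_eq_card hl, Fintype.card_fin] at htcard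
  have hc : AlgebraicIndependent ℚ c := by
    refine (AlgebraicIndependent.of_isAlgebraic_adjoin htcard hti fun x hx => ?_).1
    rcases hts hx with ⟨j, rfl⟩ | ⟨j, rfl⟩
    · exact hlc j
    · exact isAlgebraic_algebraMap
        (⟨c j, Algebra.subset_adjoin ⟨j, rfl⟩⟩ : Algebra.adjoin ℚ (Set.range c))
  have hk : Function.Injective fun (e : Fin n → Fin (N + 1)) (j : Fin d) =>
      ∑ i, M i j * (e i : ℤ) := by
    intro e e' hee
    by_contra hne
    refine hN (fun i => (e i : ℤ) - e' i) (fun h => hne (funext fun i => Fin.ext ?_))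
      (fun i => ?_) ?_
    · have := congrFun h i
      simp only [Pi.zero_apply] at this
      omega
    · have h1 := (e i).2
      have h2 := (e' i).2
      rw [abs_le]
      omega
    · have h : ∀ j, ∑ i, ((e i : ℂ) - e' i) * M i j = 0 := fun j => by
        have := congrFun hee j
        simp only at this
        rw [← sub_eq_zero, ← Finset.sum_sub_distrib] at this
        have := congrArg (Int.cast : ℤ → ℂ) this
        push_cast at this
        rw [← this]
        exact Finset.sum_congr rfl fun i _ => by ring
      push_cast
      simp only [← hM, Finset.mul_sum, ← mul_assoc]
      rw [Finset.sum_comm]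
      simp only [← Finset.sum_mul, h, zero_mul, Finset.sum_const_zero]
  have hli : LinearIndependent ℚ fun e : Fin n → Fin (N + 1) => ∏ i, exp (a i) ^ (e i : ℕ) := by
    have hmon : ∀ e : Fin n → Fin (N + 1), ∏ i, exp (a i) ^ (e i : ℕ) =
        ∏ j, c j ^ ∑ i, M i j * (e i : ℤ) := fun e => by
      simp only [hb, ← Finset.prod_pow]
      rw [Finset.prod_comm]
      refine Finset.prod_congr rfl fun j _ => ?_
      simp only [c, ← exp_int_mul, ← exp_nat_mul, ← exp_sum]
      push_cast
      rw [Finset.sum_mul]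
      exact congrArg exp (Finset.sum_congr rfl fun i _ => by ring)
    simp only [hmon]
    exact hc.linearIndependent_prod_zpow hk
  have haU : ∀ i, a i ∈ Submodule.span ℚ (insert 1 (Set.range l)) := fun i => by
    rw [← hM]
    refine sum_mem fun j _ => ?_
    rw [← zsmul_eq_mul]
    exact zsmul_mem (Submodule.subset_span (Set.mem_insert_of_mem _ (Set.mem_range_self j))) _
  have hcard := card_le_of_linearIndependent_monomials haU hP hlead hδ hli
  obtain ⟨k, rfl⟩ : ∃ k, n = k + 1 := ⟨n - 1, by omega⟩
  have h1 : (k + 1) * N * δ + 1 ≤ ((k + 1) * δ + 1) * (N + 1) := by nlinarith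
  have h2 := calc
    (N + 1) ^ (k + 1) ≤ ((k + 1) * N * δ + 1) ^ d * ∏ i, (P i).natDegree := hcard
    _ ≤ ((k + 1) * N * δ + 1) ^ k * ∏ i, (P i).natDegree := by gcongr <;> omega
    _ ≤ (((k + 1) * δ + 1) * (N + 1)) ^ k * ∏ i, (P i).natDegree := by gcongr
    _ = N * (N + 1) ^ k := by rw [hNdef, mul_pow, Nat.add_sub_cancel]; ring
    _ < (N + 1) * (N + 1) ^ k := by gcongr; omega
  exact absurd h2 (by rw [pow_succ']; exact lt_irrefl _)

/-- Over a variety of dimension `n`, each coordinate satisfies a polynomial relation with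
coefficients in any `n` of the coordinates. -/
theorem exists_polynomial_relation {σ : Type} [Finite σ] {n : ℕ} {V : Set (σ → ℂ)}
    {T : Set (MvPolynomial σ ℂ)} (w : MvPolynomial σ ℚ)
    (hTalg : ∀ p ∈ T, ∀ m, IsAlgebraic ℚ (MvPolynomial.coeff m p))
    (hV : V = zeroSet T ∩ {v | aeval v w ≠ 0}) (hVirr : IsZIrreducible V)
    (hVdim : zdim V = (n : WithBot ℕ∞)) (x : Fin n → σ) (s : σ) :
    ∃ P : Polynomial (MvPolynomial (Fin n) ℚ), P ≠ 0 ∧ ∀ v ∈ V,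
      P.eval₂ (aeval fun i => v (x i) : MvPolynomial (Fin n) ℚ →ₐ[ℚ] ℂ).toRingHom (v s) = 0 := by
  obtain ⟨R, hR, h⟩ := exists_rational_relation w hTalg hV hVirr
    (ι := Option (Fin n)) (by rw [hVdim, Finite.card_option, Nat.card_fin]; exact_mod_cast n.lt_succ_self)
    (fun o => o.elim s x)
  refine ⟨optionEquivLeft ℚ (Fin n) R, by simpa using hR, fun v hv => ?_⟩
  rw [← h v hv]
  refine congrArg (fun f : MvPolynomial (Option (Fin n)) ℚ →ₐ[ℚ] ℂ => f R)
    (?_ : (Polynomial.aevalTower (aeval fun i => v (x i)) (v s)).comp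
      (optionEquivLeft ℚ (Fin n)).toAlgHom = _)
  refine algHom_ext fun o => ?_
  cases o <;> simp

/-- Under Schanuel's conjecture, an exponential point on a variety of dimension `n` avoiding
finitely many proper subvarieties has transcendence degree `n`. -/
theorem SchanuelConjecture.trdegEq (hSC : SchanuelConjecture) {n δ : ℕ} {a : Fin n → ℂ}
    {P Q : Fin n → Polynomial (MvPolynomial (Fin n) ℚ)}
    (hP : ∀ i, (P i).eval₂ (aeval a : MvPolynomial (Fin n) ℚ →ₐ[ℚ] ℂ).toRingHom (exp (a i)) = 0)
    (hPlead : ∀ i, aeval a (P i).leadingCoeff ≠ 0)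
    (hδ : ∀ i j, ((P i).coeff j).totalDegree ≤ δ)
    (hQ : ∀ i, (Q i).eval₂
      (aeval fun i => exp (a i) : MvPolynomial (Fin n) ℚ →ₐ[ℚ] ℂ).toRingHom (a i) = 0)
    (hQlead : ∀ i, aeval (fun i => exp (a i)) (Q i).leadingCoeff ≠ 0)
    (hN : ∀ m : Fin n → ℤ, m ≠ 0 →
      (∀ i, |m i| ≤ ((n * δ + 1) ^ (n - 1) * ∏ i, (P i).natDegree : ℕ)) → ∑ i, m i * a i ≠ 0) :
    TrdegEq ℚ (Set.range a ∪ Set.range fun i => exp (a i)) n := by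
  have hli := hSC.linearIndependent hP hPlead hδ
    (fun i => isAlgebraic_adjoin_of_eval₂_eq_zero (hQ i) (hQlead i)) hN
  obtain ⟨t, hts, htcard, hti⟩ := hSC n a
  rw [finrank_span_eq_card hli, Fintype.card_fin] at htcard
  have halg : ∀ x ∈ Set.range a ∪ Set.range fun i => exp (a i),
      IsAlgebraic (Algebra.adjoin ℚ (Set.range a)) x := by
    rintro _ (⟨i, rfl⟩ | ⟨i, rfl⟩)
    · exact isAlgebraic_algebraMap
        (⟨a i, Algebra.subset_adjoin ⟨i, rfl⟩⟩ : Algebra.adjoin ℚ (Set.range a))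
    · exact isAlgebraic_adjoin_of_eval₂_eq_zero (hP i) (hPlead i)
  refine ⟨t, hts, htcard, hti, fun x hx => ?_⟩
  exact IntermediateField.isAlgebraic_adjoin_iff.2 <|
    (AlgebraicIndependent.of_isAlgebraic_adjoin htcard hti
      fun y hy => halg y (hts hy)).2 x (halg x hx)

theorem rename_notMem_vanishingIdeal {ι σ : Type} {V : Set (σ → ℂ)} {x : ι → σ}
    (hdom : IsZDense {y : ι → ℂ | ∃ v ∈ V, y = fun i => v (x i)}) {p : MvPolynomial ι ℂ}
    (hp : p ≠ 0) : rename x p ∉ vanishingIdeal ℂ V := fun h => hp <| hdom p <| by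
  rintro _ ⟨v, hv, rfl⟩
  simpa [aeval_rename, Function.comp_def, aeval_eq_eval] using h v hv

/-- A variety in `ℂ^n × (ℂˣ)^n` which dominates `ℂ^n` and is generically finite over it has
exponential points outside any given proper hypersurface. -/
theorem exists_exponential_point {n : ℕ} {V : Set (Fin n ⊕ Fin n → ℂ)}
    (hVirr : IsZIrreducible V) (hV0 : ∀ v ∈ V, ∀ i, v (Sum.inr i) ≠ 0)
    (hdom : IsZDense {x : Fin n → ℂ | ∃ v ∈ V, x = fun i => v (Sum.inl i)})
    {P : Fin n → Polynomial (MvPolynomial (Fin n) ℚ)} (hP0 : ∀ i, P i ≠ 0)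
    (hP : ∀ i, ∀ v ∈ V, (P i).eval₂
      (aeval fun i => v (Sum.inl i) : MvPolynomial (Fin n) ℚ →ₐ[ℚ] ℂ).toRingHom (v (Sum.inr i)) = 0)
    {w : MvPolynomial (Fin n ⊕ Fin n) ℂ} (hw : w ∉ vanishingIdeal ℂ V) :
    ∃ a : Fin n → ℂ, (∀ p ∈ vanishingIdeal ℂ V, eval (Sum.elim a fun i => exp (a i)) p = 0) ∧
      eval (Sum.elim a fun i => exp (a i)) w ≠ 0 := by
  have hI := isPrime_vanishingIdeal_of_isZIrreducible hVirr
  set I := vanishingIdeal ℂ V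
  obtain ⟨K, _, ψ, hψ⟩ : ∃ (K : Type) (_ : Field K) (ψ : MvPolynomial (Fin n ⊕ Fin n) ℂ →+* K),
      ∀ p, ψ p = 0 ↔ p ∈ I :=
    ⟨FractionRing (MvPolynomial (Fin n ⊕ Fin n) ℂ ⧸ I), inferInstance,
      (algebraMap _ _).comp (Ideal.Quotient.mk I), fun p => by
        rw [RingHom.comp_apply, IsFractionRing.to_map_eq_zero_iff, Ideal.Quotient.eq_zero_iff_mem]⟩
  let _ : Algebra (MvPolynomial (Fin n) ℂ) K := (ψ.comp (rename Sum.inl).toRingHom).toAlgebra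
  have hmap : ∀ p : MvPolynomial (Fin n) ℂ, ψ (rename Sum.inl p) = algebraMap _ K p := fun _ => rfl
  have : FaithfulSMul (MvPolynomial (Fin n) ℂ) K := by
    rw [faithfulSMul_iff_algebraMap_injective, injective_iff_map_eq_zero]
    intro p hp
    by_contra h
    exact rename_notMem_vanishingIdeal hdom h ((hψ _).1 hp)
  have halg : ∀ i, IsAlgebraic (MvPolynomial (Fin n) ℂ) (ψ (X (Sum.inr i))) := by
    intro i
    refine ⟨(P i).map (MvPolynomial.map (algebraMap ℚ ℂ)), ?_, ?_⟩
    · exact (Polynomial.map_ne_zero_iff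
        (MvPolynomial.map_injective _ (algebraMap ℚ ℂ).injective)).2 (hP0 i)
    · rw [Polynomial.aeval_def, Polynomial.eval₂_map]
      change Polynomial.eval₂ (ψ.comp ((rename Sum.inl).toRingHom.comp
        (MvPolynomial.map (algebraMap ℚ ℂ)))) _ _ = 0
      rw [← Polynomial.hom_eval₂, hψ]
      intro v hv
      rw [← hP i v hv]
      change (aeval v : _ →ₐ[ℂ] ℂ).toRingHom _ = _
      rw [Polynomial.hom_eval₂]
      congr 1
      · ext j <;> simp
      · simp
  have hy : ∀ i, ψ (X (Sum.inr i)) ≠ 0 := fun i h => by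
    obtain ⟨v, hv⟩ := hVirr.1
    exact hV0 v hv i (by simpa using (hψ _).1 h v hv)
  obtain ⟨F, S, W, D, G, H, hF, hdeg, hD, hbez, hGH, hpar⟩ :=
    exists_parametrization ψ hmap halg hy (mt (hψ w).1 hw)
  obtain ⟨a, t, hDa, hFa, hexp⟩ := exists_exp_eq_evalPair_div hF hdeg hD hbez hGH
  obtain ⟨h1, h2⟩ := hpar a t hDa hFa
  simp only [← hexp] at h1 h2
  exact ⟨a, fun p hp => h1 p ((hψ p).2 hp), h2⟩

/-- Assuming Schanuel's Conjecture, for an irreducible variety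
`V ⊆ ℂ^n × (ℂ*)^n` defined over the algebraic closure of `ℚ`, of dimension `n`,
with both projections dominant, the set of generic points `(ā, e^ā) ∈ V` is
Zariski dense in `V`. -/
theorem strong_exponential_closure_dense_generic_points
    (hSC : SchanuelConjecture) (n : ℕ) (hn : 1 ≤ n)
    (V : Set (Fin n ⊕ Fin n → ℂ))
    (T : Set (MvPolynomial (Fin n ⊕ Fin n) ℂ))
    (hTalg : ∀ p ∈ T, ∀ m, IsAlgebraic ℚ (MvPolynomial.coeff m p))
    (hV : V = zeroSet T ∩ {v | ∀ i, v (Sum.inr i) ≠ 0})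
    (hVirr : IsZIrreducible V)
    (hVdim : zdim V = (n : WithBot ℕ∞))
    (hdom₁ : IsZDense {x : Fin n → ℂ | ∃ v ∈ V, x = fun i => v (Sum.inl i)})
    (hdom₂ : IsZDense {y : Fin n → ℂ | ∃ v ∈ V, y = fun i => v (Sum.inr i)}) :
    V ⊆ zClosure {v | v ∈ V ∧ ∃ a : Fin n → ℂ,
      v = Sum.elim a (fun i => exp (a i)) ∧
      TrdegEq ℚ (Set.range a ∪ Set.range fun i => exp (a i)) n} := by
  classical
  rintro v hv _ ⟨⟨T', rfl⟩, hT'⟩ f hf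
  by_contra hfv
  have hprime := isPrime_vanishingIdeal_of_isZIrreducible hVirr
  have hfI : f ∉ vanishingIdeal ℂ V := fun h => hfv (by simpa [aeval_eq_eval] using h v hv)
  have hV' : V = zeroSet T ∩
      {v | aeval v (∏ i, X (Sum.inr i) : MvPolynomial (Fin n ⊕ Fin n) ℚ) ≠ 0} := by
    simpa [Finset.prod_ne_zero_iff] using hV
  choose P hP0 hP using fun i : Fin n =>
    exists_polynomial_relation _ hTalg hV' hVirr hVdim Sum.inl (Sum.inr i)
  choose Q hQ0 hQ using fun i : Fin n =>
    exists_polynomial_relation _ hTalg hV' hVirr hVdim Sum.inr (Sum.inl i)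
  obtain ⟨δ, hδ⟩ : ∃ δ, ∀ i j, ((P i).coeff j).totalDegree ≤ δ := by
    refine ⟨∑ i, ∑ j ∈ (P i).support, ((P i).coeff j).totalDegree, fun i j => ?_⟩
    by_cases hj : j ∈ (P i).support
    · exact (Finset.single_le_sum (f := fun j => ((P i).coeff j).totalDegree)
        (fun _ _ => Nat.zero_le _) hj).trans (Finset.single_le_sum
        (f := fun i => ∑ j ∈ (P i).support, ((P i).coeff j).totalDegree)
        (fun _ _ => Nat.zero_le _) (Finset.mem_univ i))
    · simp [Polynomial.notMem_support_iff.1 hj]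
  set N := (n * δ + 1) ^ (n - 1) * ∏ i, (P i).natDegree
  set B : Finset (Fin n → ℤ) := (Fintype.piFinset fun _ => Finset.Icc (-N : ℤ) N).erase 0
  set lin : (Fin n → ℤ) → MvPolynomial (Fin n) ℂ := fun m => ∑ i, C (m i : ℂ) * X i
  have hlin : ∀ m ∈ B, lin m ≠ 0 := fun m hm h => (Finset.mem_erase.1 hm).1 <| funext fun i => by
    simpa [lin, Pi.single_apply] using congrArg (eval (Pi.single i (1 : ℂ))) h
  have hmap : ∀ {p : MvPolynomial (Fin n) ℚ}, p ≠ 0 → MvPolynomial.map (algebraMap ℚ ℂ) p ≠ 0 :=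
    fun hp => (map_ne_zero_iff _ (MvPolynomial.map_injective _ (algebraMap ℚ ℂ).injective)).2 hp
  set w : MvPolynomial (Fin n ⊕ Fin n) ℂ := f *
    (∏ i, rename Sum.inl (MvPolynomial.map (algebraMap ℚ ℂ) (P i).leadingCoeff)) *
    (∏ i, rename Sum.inr (MvPolynomial.map (algebraMap ℚ ℂ) (Q i).leadingCoeff)) *
    ∏ m ∈ B, rename Sum.inl (lin m)
  have hw : w ∉ vanishingIdeal ℂ V := by
    refine hprime.mul_notMem (hprime.mul_notMem (hprime.mul_notMem hfI ?_) ?_) ?_ <;>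
      rw [hprime.prod_mem_iff] <;> push Not
    · exact fun i _ => rename_notMem_vanishingIdeal hdom₁
        (hmap (Polynomial.leadingCoeff_ne_zero.2 (hP0 i)))
    · exact fun i _ => rename_notMem_vanishingIdeal hdom₂
        (hmap (Polynomial.leadingCoeff_ne_zero.2 (hQ0 i)))
    · exact fun m hm => rename_notMem_vanishingIdeal hdom₁ (hlin m hm)
  obtain ⟨a, haI, haw⟩ := exists_exponential_point hVirr
    (fun v hv => by rw [hV] at hv; exact hv.2) hdom₁ hP0 hP hw
  have haV : Sum.elim a (fun i => exp (a i)) ∈ V := by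
    rw [hV]
    refine ⟨fun p hp => haI p fun v hv => ?_, fun i => exp_ne_zero _⟩
    rw [hV] at hv
    simpa [aeval_eq_eval] using hv.1 p hp
  simp only [w, map_mul, map_prod, mul_ne_zero_iff, Finset.prod_ne_zero_iff, eval_rename,
    Sum.elim_comp_inl, Sum.elim_comp_inr, eval_map, ← aeval_def] at haw
  obtain ⟨⟨⟨haf, haP⟩, haQ⟩, hal⟩ := haw
  have hm : ∀ m : Fin n → ℤ, m ≠ 0 → (∀ i, |m i| ≤ (N : ℤ)) → ∑ i, m i * a i ≠ 0 := by
    intro m hm hmN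
    have hmB : m ∈ B := by
      simpa [B, hm, Fintype.mem_piFinset, ← abs_le] using hmN
    simpa [lin] using hal m hmB
  have hPa := fun i => hP i _ haV
  have hQa := fun i => hQ i _ haV
  simp only [Sum.elim_inl, Sum.elim_inr] at hPa hQa
  have hgood := hSC.trdegEq hPa (fun i => haP i (Finset.mem_univ i)) hδ hQa
    (fun i => haQ i (Finset.mem_univ i)) hm
  exact haf (hT' ⟨haV, a, rfl, hgood⟩ f hf)
end

section
/- Let n ≥ 1 and let P₁(x̄), …, Pₙ(x̄) be nonzero polynomials in ℂ[x₁,…,xₙ]. Then there exist z₁,…,zₙ ∈ ℂ such that e^{zᵢ} = Pᵢ(z₁,…,zₙ) for every i = 1,…,n. -/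
open MvPolynomial Complex

/-- The homogenization of `p`, with `t` the homogenizing variable, as a function of `(t, y)`. -/
noncomputable def homogenizedEval {σ : Type} (p : MvPolynomial σ ℂ) (t : ℂ) (y : σ → ℂ) : ℂ :=
  ∑ k ∈ Finset.range (p.totalDegree + 1),
    t ^ (p.totalDegree - k) * eval y (homogeneousComponent k p)

lemma homogenizedEval_zero {σ : Type} (p : MvPolynomial σ ℂ) (y : σ → ℂ) :
    homogenizedEval p 0 y = eval y (homogeneousComponent p.totalDegree p) := by
  rw [homogenizedEval, Finset.sum_range_succ, Finset.sum_eq_zero]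
  · simp
  · intro k hk
    have := Finset.mem_range.mp hk
    rw [zero_pow (by omega), zero_mul]

lemma eval_smul_of_isHomogeneous {σ : Type} {p : MvPolynomial σ ℂ} {d : ℕ}
    (hp : p.IsHomogeneous d) (t : ℂ) (x : σ → ℂ) :
    eval (t • x) p = t ^ d * eval x p := by
  rw [eval_eq, eval_eq, Finset.mul_sum]
  refine Finset.sum_congr rfl fun m hm => ?_
  have hd : ∑ i ∈ m.support, m i = d := by
    rw [← hp (mem_support_iff.mp hm), Finsupp.weight_apply]
    simp [Finsupp.sum]
  simp only [Pi.smul_apply, smul_eq_mul, mul_pow, Finset.prod_mul_distrib,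
    Finset.prod_pow_eq_pow_sum, hd]
  ring

lemma homogenizedEval_smul {σ : Type} (p : MvPolynomial σ ℂ) (t : ℂ) (x : σ → ℂ) :
    homogenizedEval p t (t • x) = t ^ p.totalDegree * eval x p := by
  have h : eval x p = ∑ k ∈ Finset.range (p.totalDegree + 1),
      eval x (homogeneousComponent k p) := by
    rw [← map_sum, sum_homogeneousComponent]
  rw [h, Finset.mul_sum]
  refine Finset.sum_congr rfl fun k hk => ?_
  have := Finset.mem_range.mp hk
  rw [eval_smul_of_isHomogeneous (homogeneousComponent_isHomogeneous k p), ← mul_assoc, ← pow_add]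
  congr 2
  omega

lemma homogeneousComponent_totalDegree_ne_zero {σ : Type} {p : MvPolynomial σ ℂ} (hp : p ≠ 0) :
    homogeneousComponent p.totalDegree p ≠ 0 := by
  obtain ⟨m, hm, hd⟩ := Finset.exists_mem_eq_sup p.support (support_nonempty.mpr hp)
    fun m => m.sum fun _ e => e
  intro h
  have hc := congrArg (coeff m) h
  rw [coeff_homogeneousComponent, if_pos, coeff_zero] at hc
  · exact mem_support_iff.mp hm hc
  · rw [totalDegree, hd]
    rfl

lemma contDiff_eval {σ : Type} [Fintype σ] (p : MvPolynomial σ ℂ) :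
    ContDiff ℂ 1 fun y : σ → ℂ => eval y p := by
  induction p using MvPolynomial.induction_on with
  | C a => simpa using contDiff_const
  | add p q hp hq => simpa using hp.add hq
  | mul_X p i hp => simpa using hp.mul (contDiff_apply ℂ ℂ i)

lemma contDiff_homogenizedEval {σ : Type} [Fintype σ] (p : MvPolynomial σ ℂ) :
    ContDiff ℂ 1 fun v : ℂ × (σ → ℂ) => homogenizedEval p v.1 v.2 := by
  unfold homogenizedEval
  exact ContDiff.sum fun k _ =>
    (contDiff_fst.pow _).mul ((contDiff_eval (homogeneousComponent k p)).comp contDiff_snd)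

lemma exists_int_eval_ne_zero {σ : Type} (p : MvPolynomial σ ℂ) (hp : p ≠ 0) :
    ∃ q : σ → ℤ, eval (fun i => (q i : ℂ) * (2 * Real.pi * I)) p ≠ 0 := by
  by_contra! h
  have hinj : Function.Injective fun k : ℤ => (k : ℂ) * (2 * Real.pi * I) := fun a b hab => by
    simpa [Real.pi_ne_zero] using hab
  refine hp (MvPolynomial.funext_set
    (fun _ : σ => Set.range fun k : ℤ => (k : ℂ) * (2 * Real.pi * I))
    (fun _ => Set.infinite_range_of_injective hinj) fun x hx => ?_)
  choose q hq using fun i => hx i (Set.mem_univ i)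
  rw [map_zero, ← h q]
  congr 2
  exact (funext hq).symm

/-- The equations `c i * exp (u i) = G i (t, a + s + t u)` are solvable in `u` for all small
parameters `t` and `s`, provided `c i = G i (0, a)` is nonzero. -/
lemma eventually_exists_exp_eq {σ : Type} [Fintype σ] (G : σ → ℂ × (σ → ℂ) → ℂ)
    (hG : ∀ i, ContDiff ℂ 1 (G i)) (a : σ → ℂ) (ha : ∀ i, G i (0, a) ≠ 0) :
    ∀ᶠ v : ℂ × (σ → ℂ) in nhds (0, 0), ∃ u : σ → ℂ, ∀ i,
      G i (0, a) * exp (u i) = G i (v.1, a + v.2 + v.1 • u) := by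
  let E := (ℂ × (σ → ℂ)) × (σ → ℂ)
  let Y : E → ℂ × (σ → ℂ) := fun e => (e.1.1, a + e.1.2 + e.1.1 • e.2)
  let F : E → E := fun e => (e.1, fun i => G i (0, a) * exp (e.2 i) - G i (Y e))
  let A : E →L[ℂ] (ℂ × (σ → ℂ)) := ContinuousLinearMap.fst ℂ _ _
  let B : E →L[ℂ] (σ → ℂ) := ContinuousLinearMap.snd ℂ _ _
  have hY : HasStrictFDerivAt Y A 0 := by
    have h1 : HasStrictFDerivAt (fun e : E => e.1.1)
        ((ContinuousLinearMap.fst ℂ _ _).comp A) 0 :=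
      ((ContinuousLinearMap.fst ℂ ℂ (σ → ℂ)).comp A).hasStrictFDerivAt
    have h2 : HasStrictFDerivAt (fun e : E => e.1.2)
        ((ContinuousLinearMap.snd ℂ _ _).comp A) 0 :=
      ((ContinuousLinearMap.snd ℂ ℂ (σ → ℂ)).comp A).hasStrictFDerivAt
    have h3 : HasStrictFDerivAt (fun e : E => e.2) B 0 := B.hasStrictFDerivAt
    refine (h1.prodMk ((h2.const_add a).add (h1.smul h3))).congr_fderiv ?_
    ext e <;> simp [A, B]
  have hY0 : Y 0 = (0, a) := by simp [Y]
  let D : σ → E →L[ℂ] ℂ := fun i =>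
    G i (0, a) • (ContinuousLinearMap.proj i).comp B - (fderiv ℂ (G i) (0, a)).comp A
  have hF : HasStrictFDerivAt F (A.prod (ContinuousLinearMap.pi D)) 0 := by
    refine A.hasStrictFDerivAt.prodMk (hasStrictFDerivAt_pi.mpr fun i => ?_)
    have h1 : HasStrictFDerivAt (fun e : E => e.2 i) ((ContinuousLinearMap.proj i).comp B) 0 :=
      ((ContinuousLinearMap.proj i).comp B).hasStrictFDerivAt
    have h2 : HasStrictFDerivAt (G i) (fderiv ℂ (G i) (0, a)) (Y 0) := by
      rw [hY0]
      exact (hG i).contDiffAt.hasStrictFDerivAt one_ne_zero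
    refine ((h1.cexp.const_mul (G i (0, a))).sub (h2.comp 0 hY)).congr_fderiv ?_
    simp [D]
  have hsurj : (A.prod (ContinuousLinearMap.pi D)).range = ⊤ := by
    rw [LinearMap.range_eq_top]
    rintro ⟨v, w⟩
    refine ⟨(v, fun i => (w i + fderiv ℂ (G i) (0, a) v) / G i (0, a)), Prod.ext rfl (funext fun i => ?_)⟩
    change G i (0, a) * ((w i + fderiv ℂ (G i) (0, a) v) / G i (0, a)) -
      fderiv ℂ (G i) (0, a) v = w i
    rw [mul_div_cancel₀ _ (ha i), add_sub_cancel_right]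
  have hmap := hF.map_nhds_eq_of_surj hsurj
  have hF0 : F 0 = 0 := by
    ext i
    · simp [F]
    · simp [F]
    · simp [F, hY0]
  rw [hF0] at hmap
  have hrange : ∀ᶠ e in nhds (0 : E), e ∈ Set.range F := by
    rw [← hmap]
    exact Filter.eventually_map.mpr (Filter.Eventually.of_forall fun e => ⟨e, rfl⟩)
  have hcont : Filter.Tendsto (fun v : ℂ × (σ → ℂ) => ((v, 0) : E)) (nhds (0, 0)) (nhds 0) :=
    (Continuous.prodMk_left (0 : σ → ℂ)).tendsto' _ _ rfl
  filter_upwards [hcont.eventually hrange] with v ⟨e, he⟩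
  refine ⟨e.2, fun i => ?_⟩
  have h1 : e.1 = v := congrArg Prod.fst he
  have h2 := congrFun (congrArg Prod.snd he) i
  rw [← h1]
  exact sub_eq_zero.mp h2

lemma tendsto_mul_log_add_div (d c : ℂ) :
    Filter.Tendsto (fun m : ℕ => (m : ℂ)⁻¹ * (d * (Real.log m : ℂ) + c)) Filter.atTop
      (nhds 0) := by
  have h1 : Filter.Tendsto (fun m : ℕ => ((Real.log m / m : ℝ) : ℂ)) Filter.atTop (nhds 0) := by
    have h := (Real.isLittleO_log_id_atTop.tendsto_div_nhds_zero).comp tendsto_natCast_atTop_atTop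
    exact (continuous_ofReal.tendsto' 0 0 ofReal_zero).comp h
  have h2 : Filter.Tendsto (fun m : ℕ => (m : ℂ)⁻¹) Filter.atTop (nhds 0) :=
    tendsto_inv_atTop_nhds_zero_nat
  have h := (h1.const_mul d).add (h2.mul_const c)
  simp only [mul_zero, zero_mul, add_zero] at h
  refine h.congr fun m => ?_
  push_cast
  ring

/-- for nonzero polynomials `P₁,…,Pₙ ∈ ℂ[x₁,…,xₙ]` the system
`e^{zᵢ} = Pᵢ(z₁,…,zₙ)` has a solution in `ℂ^n`. -/
theorem exp_system_solvable (n : ℕ) (hn : 1 ≤ n)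
    (P : Fin n → MvPolynomial (Fin n) ℂ) (hP : ∀ i, P i ≠ 0) :
    ∃ z : Fin n → ℂ, ∀ i, exp (z i) = eval z (P i) := by
  obtain ⟨q, hq⟩ := exists_int_eval_ne_zero
    (∏ i, homogeneousComponent (P i).totalDegree (P i))
    (Finset.prod_ne_zero_iff.mpr fun i _ => homogeneousComponent_totalDegree_ne_zero (hP i))
  set a : Fin n → ℂ := fun i => (q i : ℂ) * (2 * Real.pi * I) with ha
  have hc : ∀ i, homogenizedEval (P i) 0 a ≠ 0 := fun i => by
    rw [homogenizedEval_zero]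
    rw [map_prod] at hq
    exact Finset.prod_ne_zero_iff.mp hq i (Finset.mem_univ i)
  let w : ℕ → Fin n → ℂ := fun m i =>
    (P i).totalDegree * (Real.log m : ℂ) + log (homogenizedEval (P i) 0 a)
  have hlim : Filter.Tendsto (fun m : ℕ => ((m : ℂ)⁻¹, (m : ℂ)⁻¹ • w m)) Filter.atTop
      (nhds (0, 0)) :=
    tendsto_inv_atTop_nhds_zero_nat.prodMk_nhds
      (tendsto_pi_nhds.mpr fun i => tendsto_mul_log_add_div _ _)
  obtain ⟨m, ⟨u, hu⟩, hm⟩ := ((hlim.eventually (eventually_exists_exp_eq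
    (fun i v => homogenizedEval (P i) v.1 v.2) (fun i => contDiff_homogenizedEval (P i)) a
    hc)).and (Filter.eventually_gt_atTop 0)).exists
  have hm0 : (m : ℂ) ≠ 0 := Nat.cast_ne_zero.mpr hm.ne'
  refine ⟨(m : ℂ) • a + w m + u, fun i => ?_⟩
  have hz : a + (m : ℂ)⁻¹ • w m + (m : ℂ)⁻¹ • u = (m : ℂ)⁻¹ • ((m : ℂ) • a + w m + u) := by
    rw [smul_add, smul_add, inv_smul_smul₀ hm0]
  have hui := hu i
  simp only [hz, homogenizedEval_smul] at hui
  have hexp : exp ((m : ℂ) * a i) = 1 :=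
    exp_eq_one_iff.mpr ⟨m * q i, by simp only [ha]; push_cast; ring⟩
  have hw : exp (w m i) = (m : ℂ) ^ (P i).totalDegree * homogenizedEval (P i) 0 a := by
    simp only [w]
    rw [exp_add, exp_log (hc i), exp_nat_mul, ← ofReal_exp, Real.exp_log (Nat.cast_pos.mpr hm),
      ofReal_natCast]
  rw [Pi.add_apply, Pi.add_apply, Pi.smul_apply, smul_eq_mul, exp_add, exp_add, hexp, hw, one_mul,
    mul_assoc, hui, ← mul_assoc, ← mul_pow, mul_inv_cancel₀ hm0, one_pow, one_mul]
end
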